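/- arXiv:0808.3499 — 2 statements merged into one kernel-verified Lean document; each statement's English description precedes it below -/
import Mathlib

section
/- Assume condition (INV), let D be a simply connected domain containing p_0, …, p_{S+1}, and let g be analytic on D. If φ_1 and φ_2 are polynomials in ℂ^N[x] of degree at most S such that the corrected equations y'(x) + B(x) y(x) = Q(x)^{−1}[g(x) − φ_i(x)] admit solutions y_1, respectively y_2, analytic on D, then φ_1 = φ_2 and y_1 = y_2. -/
open Matrix Set

section Aux
open Filter Topology Metric
theorem aux_punctured (x : ℂ) (r : ℝ) (hr : 0 < r) : IsPreconnected (ball x r \ {x}) := by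
  have h1 : IsPreconnected ({0}ᶜ : Set ℂ) :=
    (isConnected_compl_singleton_of_one_lt_rank (by simp) 0).isPreconnected
  have h2 := h1.image (OpenPartialHomeomorph.univBall x r)
    (OpenPartialHomeomorph.continuous_univBall x r).continuousOn
  convert h2 using 1
  have hs := OpenPartialHomeomorph.univBall_source x r
  have ht := OpenPartialHomeomorph.univBall_target x hr
  ext z
  constructor
  · rintro ⟨hz, hzx⟩
    rw [← ht] at hz
    refine ⟨(OpenPartialHomeomorph.univBall x r).symm z, ?_, OpenPartialHomeomorph.right_inv _ hz⟩
    intro h0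
    apply hzx
    have := OpenPartialHomeomorph.right_inv _ hz
    rw [mem_singleton_iff.1 h0] at this
    simpa using this.symm
  · rintro ⟨w, hw, rfl⟩
    refine ⟨?_, ?_⟩
    · rw [← ht]; exact OpenPartialHomeomorph.map_source _ (by rw [hs]; trivial)
    · intro h
      apply hw
      have h0 : OpenPartialHomeomorph.univBall x r w = OpenPartialHomeomorph.univBall x r 0 := by
        simpa using h
      exact (OpenPartialHomeomorph.univBall x r).injOn (by rw [hs]; trivial) (by rw [hs]; trivial) h0

theorem aux_diff_preconn (D F : Set ℂ) (hD : IsOpen D) (hc : IsPreconnected D) (hF : F.Finite) :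
    IsPreconnected (D \ F) := by
  have hloc : ∀ x ∈ D, ∃ r > 0, ball x r ⊆ D ∧ IsPreconnected (ball x r \ F) := by
    intro x hx
    have h1 : (F \ {x})ᶜ ∈ 𝓝 x :=
      (hF.subset Set.sdiff_subset).isClosed.isOpen_compl.mem_nhds (by simp)
    obtain ⟨r, hr, h⟩ := Metric.mem_nhds_iff.1 (inter_mem (hD.mem_nhds hx) h1)
    refine ⟨r, hr, fun z hz => (h hz).1, ?_⟩
    by_cases hxF : x ∈ F
    · have : ball x r \ F = ball x r \ {x} := by
        ext z
        constructor
        · rintro ⟨hz, hzF⟩; exact ⟨hz, fun e => hzF (by rw [mem_singleton_iff.1 e]; exact hxF)⟩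
        · rintro ⟨hz, hzF⟩; exact ⟨hz, fun e => (h hz).2 ⟨e, hzF⟩⟩
      rw [this]; exact aux_punctured x r hr
    · have : ball x r \ F = ball x r := by
        ext z
        constructor
        · exact fun h => h.1
        · intro hz
          exact ⟨hz, fun e => (h hz).2 ⟨e, fun e' => hxF (by rw [← mem_singleton_iff.1 e']; exact e)⟩⟩
      rw [this]; exact isPreconnected_ball
  have hne : ∀ x ∈ D, (𝓝[D \ F] x).NeBot := by
    intro x hx
    rw [← mem_closure_iff_nhdsWithin_neBot]
    have hd : Dense Fᶜ := hF.countable.dense_compl ℝ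
    exact hd.open_subset_closure_inter hD hx
  apply isPreconnected_of_forall_pair
  intro x hx y hy
  have key := hc.induction₂ (fun x y => ∀ᶠ x' in 𝓝[D \ F] x, ∀ᶠ y' in 𝓝[D \ F] y,
    ∃ t ⊆ D \ F, x' ∈ t ∧ y' ∈ t ∧ IsPreconnected t) ?_ ?_ ?_ hx.1 hy.1
  · exact (key.self_of_nhdsWithin hx).self_of_nhdsWithin hy
  · intro x hx
    obtain ⟨r, hr, hb, hp⟩ := hloc x hx
    filter_upwards [mem_nhdsWithin_of_mem_nhds (ball_mem_nhds x hr)] with y hy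
    filter_upwards [mem_nhdsWithin_of_mem_nhds (ball_mem_nhds x hr), self_mem_nhdsWithin] with x' hx' hx''
    filter_upwards [mem_nhdsWithin_of_mem_nhds (isOpen_ball.mem_nhds hy), self_mem_nhdsWithin] with y' hy' hy''
    exact ⟨ball x r \ F, Set.sdiff_subset_sdiff_left hb, ⟨hx', hx''.2⟩, ⟨hy', hy''.2⟩, hp⟩
  · intro x y z hx hy hz hxy hyz
    filter_upwards [hxy] with x' hx'
    have := hne y hy
    obtain ⟨y', h1, h2⟩ := (hx'.and hyz).exists
    filter_upwards [h2] with z' hz'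
    obtain ⟨t, ht, a, b, c⟩ := h1
    obtain ⟨t', ht', a', b', c'⟩ := hz'
    exact ⟨t ∪ t', union_subset ht ht', Or.inl a, Or.inr b', c.union y' b a' c'⟩
  · intro x y hx hy hxy
    obtain ⟨r, hr, hb, hp⟩ := hloc x hx
    obtain ⟨r', hr', hb', hp'⟩ := hloc y hy
    have := hne x hx
    have := hne y hy
    obtain ⟨x1, h1, h2, h3⟩ := (hxy.and ((eventually_mem_set.2 (mem_nhdsWithin_of_mem_nhds (ball_mem_nhds x hr))).and eventually_mem_nhdsWithin)).exists
    obtain ⟨y1, ⟨t, ht, a, b, c⟩, h5, h6⟩ := (h1.and ((eventually_mem_set.2 (mem_nhdsWithin_of_mem_nhds (ball_mem_nhds y hr'))).and eventually_mem_nhdsWithin)).exists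
    filter_upwards [mem_nhdsWithin_of_mem_nhds (ball_mem_nhds y hr'), self_mem_nhdsWithin] with y' hy' hy''
    filter_upwards [mem_nhdsWithin_of_mem_nhds (ball_mem_nhds x hr), self_mem_nhdsWithin] with x' hx' hx''
    refine ⟨(ball x r \ F ∪ t) ∪ (ball y r' \ F), union_subset (union_subset (Set.sdiff_subset_sdiff_left hb) ht)
      (Set.sdiff_subset_sdiff_left hb'), Or.inr ⟨hy', hy''.2⟩, Or.inl (Or.inl ⟨hx', hx''.2⟩), ?_⟩
    have q1 : x1 ∈ ball x r \ F := ⟨h2, h3.2⟩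
    have q2 : y1 ∈ ball y r' \ F := ⟨h5, h6.2⟩
    have q3 : IsPreconnected (ball x r \ F ∪ t) := hp.union x1 q1 a c
    exact q3.union y1 (Or.inr b) q2 hp'

theorem aux_push_local (U : Set ℂ) (hU : IsOpen U) (a : ℂ) (ha : a ∈ U) :
    ∀ᶠ b in 𝓝 a, ∃ Φ : ℂ ≃ₜ ℂ, (∀ z ∉ U, Φ z = z) ∧ Φ a = b := by
  obtain ⟨r, hr, h⟩ := Metric.mem_nhds_iff.1 (hU.mem_nhds ha)
  filter_upwards [ball_mem_nhds a (half_pos hr)] with b hb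
  let χ : ℂ → ℝ := fun z => max 0 (1 - dist z a / r)
  let f : ℂ → ℂ := fun z => z + (χ z : ℂ) * (b - a)
  have hχ : ∀ z w, |χ z - χ w| ≤ dist z w / r := by
    intro z w
    have h0 : |χ z - χ w| ≤ |(1 - dist z a / r) - (1 - dist w a / r)| := by
      simp only [χ, max_comm (0 : ℝ)]
      exact abs_max_sub_max_le_abs _ _ _
    refine h0.trans ?_
    have h1 : (1 - dist z a / r) - (1 - dist w a / r) = (dist w a - dist z a) / r := by ring
    rw [h1, abs_div, abs_of_pos hr]
    gcongr
    rw [dist_comm z w]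
    exact abs_dist_sub_le w z a
  have hf : ApproximatesLinearOn f ((ContinuousLinearEquiv.refl ℂ ℂ : ℂ ≃L[ℂ] ℂ) : ℂ →L[ℂ] ℂ) univ (1/2) := by
    intro z _ w _
    have h1 : f z - f w - ((ContinuousLinearEquiv.refl ℂ ℂ : ℂ ≃L[ℂ] ℂ) : ℂ →L[ℂ] ℂ) (z - w)
        = ((χ z - χ w : ℝ) : ℂ) * (b - a) := by
      simp [f]; ring
    rw [h1, norm_mul, Complex.norm_real, Real.norm_eq_abs]
    have h2 : ‖b - a‖ ≤ r / 2 := by rw [← dist_eq_norm]; exact (mem_ball.1 hb).le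
    calc |χ z - χ w| * ‖b - a‖ ≤ (dist z w / r) * (r / 2) := by
          gcongr
          exact hχ z w
      _ = _ := by rw [dist_eq_norm]; field_simp; simp
  have hc : Subsingleton ℂ ∨ (1/2 : NNReal) < ‖(((ContinuousLinearEquiv.refl ℂ ℂ : ℂ ≃L[ℂ] ℂ).symm : ℂ →L[ℂ] ℂ))‖₊⁻¹ := by
    right
    have : ‖(((ContinuousLinearEquiv.refl ℂ ℂ : ℂ ≃L[ℂ] ℂ).symm : ℂ →L[ℂ] ℂ))‖₊ = 1 := by
      ext; simp
    rw [this, inv_one]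
    exact NNReal.half_lt_self one_ne_zero
  refine ⟨hf.toHomeomorph f hc, ?_, ?_⟩
  · intro z hz
    change f z = z
    have : r ≤ dist z a := by
      by_contra hlt
      exact hz (h (mem_ball.2 (not_le.1 hlt)))
    have : χ z = 0 := by
      apply max_eq_left
      rw [sub_nonpos]
      exact (one_le_div hr).2 this
    simp [f, this]
  · change f a = b
    simp [f, χ]

theorem aux_push (U : Set ℂ) (hU : IsOpen U) (hc : IsPreconnected U) (a b : ℂ) (ha : a ∈ U) (hb : b ∈ U) :
    ∃ Φ : ℂ ≃ₜ ℂ, (∀ z ∉ U, Φ z = z) ∧ Φ a = b := by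
  refine hc.induction₂ (fun a b => ∃ Φ : ℂ ≃ₜ ℂ, (∀ z ∉ U, Φ z = z) ∧ Φ a = b) ?_ ?_ ?_ ha hb
  · intro x hx
    exact nhdsWithin_le_nhds (aux_push_local U hU x hx)
  · rintro x y z - - - ⟨Φ, h1, h2⟩ ⟨Ψ, h3, h4⟩
    exact ⟨Φ.trans Ψ, fun w hw => by simp [h1 w hw, h3 w hw], by simp [h2, h4]⟩
  · rintro x y - - ⟨Φ, h1, h2⟩
    exact ⟨Φ.symm, fun w hw => by rw [Homeomorph.symm_apply_eq, h1 w hw],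
      by rw [Homeomorph.symm_apply_eq, h2]⟩

theorem aux_collect (D : Set ℂ) (hD : IsOpen D) (hc : IsPreconnected D) (c : ℂ) (r : ℝ) (hr : 0 < r)
    (hb : ball c r ⊆ D) (P : Finset ℂ) (hP : ∀ x ∈ P, x ∈ D) :
    ∃ Φ : ℂ ≃ₜ ℂ, (∀ z ∉ D, Φ z = z) ∧ ∀ x ∈ P, Φ x ∈ ball c r := by
  classical
  induction P using Finset.induction_on with
  | empty => exact ⟨Homeomorph.refl ℂ, by simp, by simp⟩
  | insert p P hp ih =>
    obtain ⟨Φ, h1, h2⟩ := ih (fun x hx => hP x (Finset.mem_insert_of_mem hx))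
    have hF : (Φ '' (P : Set ℂ)).Finite := P.finite_toSet.image _
    have hmem : Φ p ∈ D := by
      by_contra hn
      have h3 := h1 _ hn
      have h4 := Φ.injective h3
      rw [h4] at hn
      exact hn (hP p (Finset.mem_insert_self _ _))
    have hinf : (ball c r).Infinite := infinite_of_mem_nhds c (ball_mem_nhds c hr)
    obtain ⟨b, hb1, hb2⟩ := (hinf.sdiff hF).nonempty
    have hpF : Φ p ∉ Φ '' (P : Set ℂ) := by
      rintro ⟨q, hq, e⟩
      exact hp (by rw [← Φ.injective e]; exact hq)
    obtain ⟨Ψ, h3, h4⟩ := aux_push (D \ Φ '' (P : Set ℂ)) (hD.sdiff hF.isClosed)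
      (aux_diff_preconn D _ hD hc hF) (Φ p) b ⟨hmem, hpF⟩ ⟨hb hb1, hb2⟩
    refine ⟨Φ.trans Ψ, fun z hz => ?_, fun x hx => ?_⟩
    · simp [h1 z hz, h3 z (fun h => hz h.1)]
    · rcases Finset.mem_insert.1 hx with rfl | hx
      · simpa [h4] using hb1
      · have : Ψ (Φ x) = Φ x := h3 _ (fun h => h.2 ⟨x, hx, rfl⟩)
        simpa [this] using h2 x hx
theorem aux_extend {E : Type*} (P : Set ℂ) (hPf : P.Finite) (G : (ℂ → E) → ℂ → Prop)
    (c : ℂ) (r : ℝ) (hr : 0 < r) (hP : P ⊆ ball c r)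
    (hgerm : ∀ s s' w, s =ᶠ[𝓝 w] s' → G s w → G s' w)
    (huniq : ∀ W : Set ℂ, IsOpen W → IsPreconnected W → (∀ w ∈ W, w ∉ P) → ∀ s s' : ℂ → E,
      (∀ w ∈ W, G s w) → (∀ w ∈ W, G s' w) → ∀ v ∈ W, s v = s' v → EqOn s s' W)
    (hex : ∀ w, w ∉ P → ∃ ρ > 0, (∀ z ∈ ball w ρ, z ∉ P) ∧
      ∀ v ∈ ball w ρ, ∀ a, ∃ s : ℂ → E, s v = a ∧ ∀ z ∈ ball w ρ, G s z)
    (s0 : ℂ → E) (hs0 : ∀ z ∈ ball c r \ P, G s0 z) :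
    ∃ s, EqOn s s0 (ball c r) ∧ ∀ z, z ∉ P → G s z := by
  classical
  let X : ℝ → (ℂ → E) → Prop := fun t s => EqOn s s0 (ball c r) ∧ ∀ z ∈ ball c t \ P, G s z
  obtain ⟨v0, hv0, hv0P⟩ := ((infinite_of_mem_nhds c (ball_mem_nhds c hr)).sdiff hPf).nonempty
  have hun : ∀ t, r ≤ t → ∀ s s', X t s → X t s' → EqOn s s' (ball c t) := by
    intro t ht s s' h h'
    have h1 := huniq (ball c t \ P) (isOpen_ball.sdiff hPf.isClosed)
      (aux_diff_preconn _ _ isOpen_ball isPreconnected_ball hPf) (fun w hw => hw.2) s s' h.2 h'.2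
      v0 ⟨ball_subset_ball ht hv0, hv0P⟩ (by rw [h.1 hv0, h'.1 hv0])
    intro z hz
    by_cases hzP : z ∈ P
    · rw [h.1 (hP hzP), h'.1 (hP hzP)]
    · exact h1 ⟨hz, hzP⟩
  have hmono : ∀ t t' s, t ≤ t' → X t' s → X t s := fun t t' s htt h =>
    ⟨h.1, fun z hz => h.2 z ⟨ball_subset_ball htt hz.1, hz.2⟩⟩
  let A : Set ℝ := {t | r ≤ t ∧ ∃ s, X t s}
  have hrA : r ∈ A := ⟨le_rfl, s0, fun _ _ => rfl, hs0⟩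
  have hunion : ∃ s, ∀ t ∈ A, X t s := by
    have hch : ∀ t : A, ∃ s, X t s := fun t => t.2.2
    choose σ hσ using hch
    let s : ℂ → E := fun z => if h : ∃ t : A, z ∈ ball c (t : ℝ) then σ h.choose z else s0 z
    have hs : ∀ t : A, EqOn s (σ t) (ball c t) := by
      intro t z hz
      have h : ∃ t : A, z ∈ ball c (t : ℝ) := ⟨t, hz⟩
      have e : s z = σ h.choose z := dif_pos h
      rw [e]
      have h2 := h.choose_spec
      generalize h.choose = t' at h2 ⊢
      rcases le_total (t : ℝ) t' with hle | hle
      · exact hun t t.2.1 _ _ (hmono _ _ _ hle (hσ t')) (hσ t) hz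
      · exact hun t' t'.2.1 _ _ (hσ t') (hmono _ _ _ hle (hσ t)) h2
    refine ⟨s, fun t ht => ⟨fun z hz => ?_, fun z hz => ?_⟩⟩
    · rw [hs ⟨t, ht⟩ (ball_subset_ball ht.1 hz)]
      exact (hσ ⟨t, ht⟩).1 hz
    · refine hgerm (σ ⟨t, ht⟩) s z ?_ ((hσ ⟨t, ht⟩).2 z hz)
      filter_upwards [isOpen_ball.mem_nhds hz.1] with z' hz'
      exact (hs ⟨t, ht⟩ hz').symm
  have hstep : ∀ T ∈ A, ∃ δ > 0, T + δ ∈ A := by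
    rintro T ⟨hrT, s, hs⟩
    have hT : 0 < T := hr.trans_le hrT
    have hsP : ∀ w ∈ sphere c T, w ∉ P := by
      intro w hw hwP
      have := mem_ball.1 (hP hwP)
      rw [mem_sphere.1 hw] at this
      exact absurd this (not_lt.2 hrT)
    have hex' : ∀ w : sphere c T, ∃ ρ > 0, (∀ z ∈ ball (w : ℂ) ρ, z ∉ P) ∧
      ∀ v ∈ ball (w : ℂ) ρ, ∀ a, ∃ s : ℂ → E, s v = a ∧ ∀ z ∈ ball (w : ℂ) ρ, G s z :=
      fun w => hex w (hsP w w.2)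
    choose ρ hρ hρP hρs using hex'
    obtain ⟨ε, hε, hleb⟩ := lebesgue_number_lemma_of_metric (isCompact_sphere c T)
      (c := fun w : sphere c T => ball (w : ℂ) (ρ w)) (fun w => isOpen_ball)
      (fun w hw => mem_iUnion.2 ⟨⟨w, hw⟩, mem_ball_self (hρ _)⟩)
    have hloc : ∀ w ∈ sphere c T, (∀ z ∈ ball w ε, z ∉ P) ∧
        ∃ τ : ℂ → E, (∀ z ∈ ball w ε, G τ z) ∧ EqOn τ s (ball w ε ∩ ball c T) := by
      intro w hw
      obtain ⟨w', hw'⟩ := hleb w hw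
      have hP1 : ∀ z ∈ ball w ε, z ∉ P := fun z hz => hρP w' z (hw' hz)
      refine ⟨hP1, ?_⟩
      have hne : (ball w ε ∩ ball c T).Nonempty := by
        have : w ∈ closure (ball c T) := by
          rw [closure_ball c hT.ne']; exact sphere_subset_closedBall hw
        obtain ⟨v, h1, h2⟩ := mem_closure_iff.1 this (ball w ε) isOpen_ball (mem_ball_self hε)
        exact ⟨v, h1, h2⟩
      obtain ⟨v, hv1, hv2⟩ := hne
      obtain ⟨τ, h1, h2⟩ := hρs w' v (hw' hv1) (s v)
      refine ⟨τ, fun z hz => h2 z (hw' hz), ?_⟩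
      exact huniq _ (isOpen_ball.inter isOpen_ball)
        ((convex_ball w ε).inter (convex_ball c T)).isPreconnected (fun z hz => hP1 z hz.1) τ s
        (fun z hz => h2 z (hw' hz.1)) (fun z hz => hs.2 z ⟨hz.2, hP1 z hz.1⟩) v ⟨hv1, hv2⟩ h1
    have hloc2 : ∀ w : ℂ, ∃ τ : ℂ → E, w ∈ sphere c T →
      ((∀ z ∈ ball w ε, G τ z) ∧ EqOn τ s (ball w ε ∩ ball c T)) := by
      intro w
      by_cases hw : w ∈ sphere c T
      · obtain ⟨τ, h⟩ := (hloc w hw).2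
        exact ⟨τ, fun _ => h⟩
      · exact ⟨s0, fun h => absurd h hw⟩
    choose τ hτ using hloc2
    let π : ℂ → ℂ := fun z => c + ((T / ‖z - c‖ : ℝ) : ℂ) * (z - c)
    have hπ : ∀ z, T ≤ dist z c → π z ∈ sphere c T ∧ dist z (π z) = dist z c - T := by
      intro z hz
      have hz0 : 0 < ‖z - c‖ := by rw [← dist_eq_norm]; exact hT.trans_le hz
      constructor
      · rw [mem_sphere, dist_eq_norm]
        simp only [π, add_sub_cancel_left, norm_mul, Complex.norm_real, Real.norm_eq_abs]
        rw [abs_of_pos (by positivity)]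
        field_simp
      · have : z - π z = ((1 - T / ‖z - c‖ : ℝ) : ℂ) * (z - c) := by
          simp only [π]; push_cast; ring
        rw [dist_eq_norm, this, norm_mul, Complex.norm_real, Real.norm_eq_abs, abs_of_nonneg, dist_eq_norm]
        · field_simp
        · rw [sub_nonneg, div_le_one hz0, ← dist_eq_norm]; exact hz
    let t : ℂ → E := fun z => if dist z c < T then s z else τ (π z) z
    have ht1 : ∀ z ∈ ball c T, t z = s z := fun z hz => if_pos hz
    have ht2 : ∀ w ∈ sphere c T, EqOn t (τ w) (ball w ε ∩ ball c (T + ε)) := by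
      intro w hw z hz
      by_cases hzT : dist z c < T
      · rw [ht1 z hzT]
        exact ((hτ w hw).2 ⟨hz.1, hzT⟩).symm
      · have e : t z = τ (π z) z := if_neg hzT
        obtain ⟨h1, h2⟩ := hπ z (not_lt.1 hzT)
        rw [e]
        generalize π z = w' at h1 h2
        by_cases hww : w = w'
        · rw [hww]
        have hzc := mem_ball.1 hz.2
        have hzw' : z ∈ ball w' ε := by rw [mem_ball, h2]; linarith
        have hd : dist w w' < 2 * ε := by
          calc dist w w' ≤ dist w z + dist z w' := dist_triangle _ _ _
            _ < 2 * ε := by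
              have := mem_ball'.1 hz.1
              have := mem_ball.1 hzw'
              linarith
        have hm1 : midpoint ℝ w w' ∈ ball w ε := by
          rw [mem_ball, dist_midpoint_left]
          norm_num; linarith
        have hm2 : midpoint ℝ w w' ∈ ball w' ε := by
          rw [mem_ball, dist_midpoint_right]
          norm_num; linarith
        have hm3 : midpoint ℝ w w' ∈ ball c T := by
          have q1 : ‖w - c‖ = T := by rw [← dist_eq_norm]; exact hw
          have q2 : ‖w' - c‖ = T := by rw [← dist_eq_norm]; exact h1
          have := (norm_midpoint_lt_iff (q1.trans q2.symm)).2 (fun h => hww (sub_left_injective h))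
          rw [mem_ball, dist_eq_norm, ← q1]
          have q3 : midpoint ℝ w w' - c = (1 / 2 : ℝ) • ((w - c) + (w' - c)) := by
            rw [midpoint_eq_smul_add]
            simp only [Complex.real_smul]
            push_cast
            simp
            ring
          rw [q3]
          exact this
        exact huniq (ball w' ε ∩ ball w ε) (isOpen_ball.inter isOpen_ball)
          ((convex_ball w' ε).inter (convex_ball w ε)).isPreconnected
          (fun z hz => (hloc w hw).1 z hz.2) (τ w') (τ w) (fun z hz => (hτ w' h1).1 z hz.1)
          (fun z hz => (hτ w hw).1 z hz.2) _ ⟨hm2, hm1⟩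
          (by rw [(hτ w hw).2 ⟨hm1, hm3⟩, (hτ w' h1).2 ⟨hm2, hm3⟩]) ⟨hzw', hz.1⟩
    refine ⟨ε, hε, by linarith, t, fun z hz => ?_, fun z hz => ?_⟩
    · rw [ht1 z (ball_subset_ball hrT hz)]; exact hs.1 hz
    · by_cases hzT : dist z c < T
      · refine hgerm s t z ?_ (hs.2 z ⟨hzT, hz.2⟩)
        filter_upwards [isOpen_ball.mem_nhds (mem_ball.2 hzT)] with z' hz'
        exact (ht1 z' hz').symm
      · obtain ⟨h1, h2⟩ := hπ z (not_lt.1 hzT)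
        have hzc := mem_ball.1 hz.1
        have hzw : z ∈ ball (π z) ε := by rw [mem_ball, h2]; linarith
        refine hgerm (τ (π z)) t z ?_ ((hτ _ h1).1 z hzw)
        filter_upwards [isOpen_ball.mem_nhds hzw, isOpen_ball.mem_nhds hz.1] with z' a b
        exact (ht2 _ h1 ⟨a, b⟩).symm
  obtain ⟨s, hs⟩ := hunion
  have hunb : ¬ BddAbove A := by
    intro hb
    have hTA : sSup A ∈ A := by
      refine ⟨le_csSup hb hrA, s, (hs r hrA).1, fun z hz => ?_⟩
      obtain ⟨t, htA, ht⟩ := exists_lt_of_lt_csSup ⟨r, hrA⟩ (mem_ball.1 hz.1)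
      exact (hs t htA).2 z ⟨ht, hz.2⟩
    obtain ⟨δ, hδ, h⟩ := hstep _ hTA
    have := le_csSup hb h
    linarith
  refine ⟨s, (hs r hrA).1, fun z hz => ?_⟩
  obtain ⟨t, htA, ht⟩ := not_bddAbove_iff.1 hunb (dist z c)
  exact (hs t htA).2 z ⟨ht, hz⟩
section ODE
variable {E : Type*} [NormedAddCommGroup E] [NormedSpace ℂ E] [CompleteSpace E]

theorem aux_ode_unique (W : Set ℂ) (hW : IsOpen W) (hc : IsPreconnected W) (A : ℂ → E →L[ℂ] E)
    (hA : ContinuousOn A W) (b : ℂ → E) (u v : ℂ → E)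
    (hu : ∀ x ∈ W, HasDerivAt u (A x (u x) + b x) x)
    (hv : ∀ x ∈ W, HasDerivAt v (A x (v x) + b x) x) (x0 : ℂ) (hx0 : x0 ∈ W) (h0 : u x0 = v x0) :
    EqOn u v W := by
  have hua : AnalyticOnNhd ℂ u W := DifferentiableOn.analyticOnNhd
    (fun x hx => (hu x hx).differentiableAt.differentiableWithinAt) hW
  have hva : AnalyticOnNhd ℂ v W := DifferentiableOn.analyticOnNhd
    (fun x hx => (hv x hx).differentiableAt.differentiableWithinAt) hW
  refine hua.eqOn_of_preconnected_of_eventuallyEq hva hc hx0 ?_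
  have hAc : ContinuousAt A x0 := hA.continuousAt (hW.mem_nhds hx0)
  have hbd : ∀ᶠ x in 𝓝 x0, ‖A x‖ < ‖A x0‖ + 1 :=
    hAc.norm.eventually_lt continuousAt_const (by linarith)
  obtain ⟨r, hr, h⟩ := Metric.eventually_nhds_iff_ball.1 (hbd.and (hW.mem_nhds hx0))
  filter_upwards [ball_mem_nhds x0 hr] with z hz
  let f : ℝ → E := fun t => u (x0 + t * (z - x0)) - v (x0 + t * (z - x0))
  let f' : ℝ → E := fun t => (z - x0) • A (x0 + t * (z - x0)) (f t)
  have hmem : ∀ t ∈ Icc (0 : ℝ) 1, x0 + t * (z - x0) ∈ ball x0 r := by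
    intro t ht
    rw [mem_ball, dist_eq_norm, add_sub_cancel_left, norm_mul, Complex.norm_real,
      Real.norm_eq_abs, abs_of_nonneg ht.1]
    have : ‖z - x0‖ < r := by rw [← dist_eq_norm]; exact hz
    nlinarith [norm_nonneg (z - x0), ht.2]
  have hd : ∀ t ∈ Icc (0 : ℝ) 1, HasDerivAt f (f' t) t := by
    intro t ht
    have hw := (h _ (hmem t ht)).2
    have h1 : HasDerivAt (fun t : ℝ => x0 + (t : ℂ) * (z - x0)) (z - x0) t := by
      have := ((Complex.ofRealCLM.hasDerivAt (x := t)).mul_const (z - x0)).const_add x0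
      simpa using this
    have h2 := ((hu _ hw).sub (hv _ hw)).scomp t h1
    have e : f' t = (z - x0) • ((A (x0 + t * (z - x0)) (u (x0 + t * (z - x0))) + b (x0 + t * (z - x0))) -
        (A (x0 + t * (z - x0)) (v (x0 + t * (z - x0))) + b (x0 + t * (z - x0)))) := by
      simp only [f', f, map_sub]
      congr 1
      abel
    rw [e]
    exact h2
  have key := eq_zero_of_abs_deriv_le_mul_abs_self_of_eq_zero_right (f := f) (f' := f')
    (K := ‖z - x0‖ * (‖A x0‖ + 1)) (a := 0) (b := 1)
    (fun t ht => (hd t ht).continuousAt.continuousWithinAt)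
    (fun t ht => (hd t (Ico_subset_Icc_self ht)).hasDerivWithinAt) (by simp [f, h0])
    (fun t ht => by
      rw [norm_smul, mul_assoc]
      gcongr
      refine (ContinuousLinearMap.le_opNorm _ _).trans ?_
      gcongr
      exact (h _ (hmem t (Ico_subset_Icc_self ht))).1.le) 1 (by simp)
  have : f 1 = u z - v z := by simp [f]
  rw [this] at key
  exact sub_eq_zero.1 key

theorem aux_cauchy (f : ℕ → E →L[ℂ] E) (g : ℕ → E) (hf : Summable fun n => ‖f n‖)
    (hg : Summable fun n => ‖g n‖) :
    ∑' n, ∑ p ∈ Finset.HasAntidiagonal.antidiagonal n, f p.2 (g p.1) = (∑' n, f n) (∑' n, g n) ∧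
    Summable (fun n => ∑ p ∈ Finset.HasAntidiagonal.antidiagonal n, f p.2 (g p.1)) := by
  have hs : Summable (fun p : ℕ × ℕ => f p.2 (g p.1)) := by
    refine Summable.of_norm_bounded (hg.mul_of_nonneg hf (fun _ => norm_nonneg _) (fun _ => norm_nonneg _)) ?_
    intro p
    rw [mul_comm]
    exact ContinuousLinearMap.le_opNorm _ _
  have h1 : ∑' p : ℕ × ℕ, f p.2 (g p.1) = (∑' n, f n) (∑' n, g n) := by
    rw [hs.tsum_prod]
    have h2 : ∀ i, ∑' j, f j (g i) = (∑' n, f n) (g i) := fun i =>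
      ((ContinuousLinearMap.apply ℂ E (g i)).map_tsum hf.of_norm).symm
    simp_rw [h2]
    exact ((∑' n, f n).map_tsum hg.of_norm).symm
  have hs2 := (Finset.HasAntidiagonal.sigmaAntidiagonalEquivProd.summable_iff (f := fun p : ℕ × ℕ => f p.2 (g p.1))).2 hs
  have h3 : ∀ n, ∑ p ∈ Finset.HasAntidiagonal.antidiagonal n, f p.2 (g p.1) =
      ∑' p : Finset.HasAntidiagonal.antidiagonal n, f (p : ℕ × ℕ).2 (g (p : ℕ × ℕ).1) := by
    intro n
    rw [tsum_fintype, Finset.sum_coe_sort _ (fun p : ℕ × ℕ => f p.2 (g p.1))]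
  simp_rw [h3]
  constructor
  · rw [← h1, ← Finset.HasAntidiagonal.sigmaAntidiagonalEquivProd.tsum_eq]
    exact (Summable.tsum_sigma' (fun n => (hasSum_fintype _).summable) hs2).symm
  · exact hs2.sigma' (fun n => (hasSum_fintype _).summable)

/-- Taylor coefficients of the solution. -/
noncomputable def auxCoef (A : ℕ → E →L[ℂ] E) (b : ℕ → E) (y0 : E) : ℕ → E
  | 0 => y0
  | k + 1 => ((k : ℂ) + 1)⁻¹ • (∑ i : Fin (k + 1), A (k - i) (auxCoef A b y0 i) + b k)
decreasing_by exact i.2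

theorem aux_series_deriv (c : ℕ → E) (L K ρ : ℝ) (hK : 0 < K) (hρ : 0 < ρ) (hρK : ρ * K ≤ 1 / 2)
    (hcb : ∀ k, ‖c k‖ ≤ L * K ^ k) (z : ℂ) (hz : z ∈ ball (0 : ℂ) ρ) :
    HasDerivAt (fun z : ℂ => ∑' n, z ^ n • c n) (∑' n : ℕ, ((n : ℂ) * z ^ (n - 1)) • c n) z := by
  have hL : 0 ≤ L := by simpa using (norm_nonneg _).trans (hcb 0)
  have hu : Summable (fun n : ℕ => (2 * L * K) * ((n : ℝ) ^ 1 * (1 / 2) ^ n)) := by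
    have hhalf : ‖(1 / 2 : ℝ)‖ < 1 := by norm_num
    have hsm := summable_pow_mul_geometric_of_norm_lt_one (R := ℝ) (r := 1 / 2) 1 hhalf
    exact hsm.mul_left _
  have hd : ∀ (n : ℕ) (y : ℂ), y ∈ ball (0 : ℂ) ρ →
      HasDerivAt (fun z : ℂ => z ^ n • c n) (((n : ℂ) * y ^ (n - 1)) • c n) y :=
    fun n y _ => (hasDerivAt_pow n y).smul_const (c n)
  have hb : ∀ (n : ℕ) (y : ℂ), y ∈ ball (0 : ℂ) ρ → ‖((n : ℂ) * y ^ (n - 1)) • c n‖ ≤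
      (2 * L * K) * ((n : ℝ) ^ 1 * (1 / 2) ^ n) := by
    intro n y hy
    have hyρ : ‖y‖ < ρ := by simpa using hy
    cases n with
    | zero => simp
    | succ n =>
      rw [norm_smul, norm_mul, norm_pow, Complex.norm_natCast, Nat.add_sub_cancel]
      calc ((n + 1 : ℕ) : ℝ) * ‖y‖ ^ n * ‖c (n + 1)‖
          ≤ ((n + 1 : ℕ) : ℝ) * ρ ^ n * (L * K ^ (n + 1)) := by
            gcongr
            exact hcb _
        _ = L * K * (((n + 1 : ℕ) : ℝ) * (ρ * K) ^ n) := by rw [mul_pow, pow_succ]; ring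
        _ ≤ L * K * (((n + 1 : ℕ) : ℝ) * (1 / 2) ^ n) := by gcongr
        _ = _ := by rw [pow_succ (1 / 2 : ℝ)]; ring
  have h0 : Summable fun n : ℕ => (0 : ℂ) ^ n • c n := by
    refine summable_of_ne_finset_zero (s := {0}) ?_
    intro n hn
    have : n ≠ 0 := by simpa using hn
    simp [this]
  exact hasDerivAt_tsum_of_isPreconnected hu isOpen_ball isPreconnected_ball hd hb (mem_ball_self hρ) h0 hz

set_option maxHeartbeats 1000000 in
theorem aux_ode_exists (A : ℂ → E →L[ℂ] E) (b : ℂ → E) (x0 : ℂ) (hA : AnalyticAt ℂ A x0)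
    (hb : AnalyticAt ℂ b x0) (y0 : E) :
    ∃ ρ > 0, ∃ u : ℂ → E, u x0 = y0 ∧ ∀ x ∈ ball x0 ρ, HasDerivAt u (A x (u x) + b x) x := by
  obtain ⟨q, hq⟩ := hA
  obtain ⟨p, hp⟩ := hb
  obtain ⟨C1, r1, hC1, hr1, hq1⟩ := q.le_mul_pow_of_radius_pos hq.radius_pos
  obtain ⟨C2, r2, hC2, hr2, hp1⟩ := p.le_mul_pow_of_radius_pos hp.radius_pos
  obtain ⟨ρ1, hρ1, hsum⟩ := Metric.eventually_nhds_iff_ball.1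
    ((hasFPowerSeriesAt_iff.1 hq).and (hasFPowerSeriesAt_iff.1 hp))
  set C := max C1 C2
  have hC : 0 < C := lt_max_of_lt_left hC1
  set K := max (max r1 r2) (2 * C)
  have hK : 0 < K := lt_max_of_lt_right (by positivity)
  have hKC : 2 * C ≤ K := le_max_right _ _
  have hAK : ∀ n, ‖q.coeff n‖ ≤ C * K ^ n := by
    intro n
    rw [← FormalMultilinearSeries.norm_apply_eq_norm_coef]
    refine (hq1 n).trans ?_
    gcongr
    · exact le_max_left _ _
    · exact (le_max_left _ _).trans (le_max_left _ _)
  have hbK : ∀ n, ‖p.coeff n‖ ≤ C * K ^ n := by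
    intro n
    rw [← FormalMultilinearSeries.norm_apply_eq_norm_coef]
    refine (hp1 n).trans ?_
    gcongr
    · exact le_max_right _ _
    · exact (le_max_right _ _).trans (le_max_left _ _)
  set c := auxCoef q.coeff p.coeff y0 with hcdef
  have hc0 : c 0 = y0 := by rw [hcdef, auxCoef]
  have hcs : ∀ k : ℕ, ((k : ℂ) + 1) • c (k + 1) =
      ∑ i ∈ Finset.HasAntidiagonal.antidiagonal k, q.coeff i.2 (c i.1) + p.coeff k := by
    intro k
    have : c (k + 1) = ((k : ℂ) + 1)⁻¹ • (∑ i : Fin (k + 1), q.coeff (k - i) (c i) + p.coeff k) := by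
      rw [hcdef, auxCoef]
    rw [this, smul_smul, mul_inv_cancel₀ (by exact_mod_cast Nat.succ_ne_zero k), one_smul]
    congr 1
    rw [Finset.Nat.sum_antidiagonal_eq_sum_range_succ (fun i j => q.coeff j (c i)), Finset.sum_range]
  clear_value c
  set L := max ‖y0‖ 1
  have hL : 1 ≤ L := le_max_right _ _
  have hcb : ∀ k, ‖c k‖ ≤ L * K ^ k := by
    intro k
    induction k using Nat.strong_induction_on with
    | _ k ih =>
      cases k with
      | zero => rw [hc0]; simp [L]
      | succ k =>
        have h1 : ((k : ℝ) + 1) * ‖c (k + 1)‖ = ‖((k : ℂ) + 1) • c (k + 1)‖ := by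
          rw [norm_smul]
          congr 1
          have : ((k : ℂ) + 1) = ((k + 1 : ℕ) : ℂ) := by push_cast; ring
          rw [this, Complex.norm_natCast]; push_cast; ring
        have h2 : ‖((k : ℂ) + 1) • c (k + 1)‖ ≤ ((k : ℝ) + 1) * (C * L * K ^ k) + C * K ^ k := by
          rw [hcs]
          refine (norm_add_le _ _).trans (add_le_add ?_ (hbK k))
          refine (norm_sum_le_of_le (f := fun i : ℕ × ℕ => q.coeff i.2 (c i.1)) (n := fun _ => C * L * K ^ k) _ ?_).trans ?_
          · intro i hi
            have hik := Finset.HasAntidiagonal.mem_antidiagonal.1 hi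
            refine (ContinuousLinearMap.le_opNorm _ _).trans ?_
            calc ‖q.coeff i.2‖ * ‖c i.1‖ ≤ (C * K ^ i.2) * (L * K ^ i.1) := by
                  gcongr
                  · exact hAK _
                  · exact ih _ (by omega)
              _ = C * L * K ^ k := by rw [← hik, pow_add]; ring
          · simp
        have h3 : ((k : ℝ) + 1) * ‖c (k + 1)‖ ≤ ((k : ℝ) + 1) * (L * K ^ (k + 1)) := by
          rw [h1]
          refine h2.trans ?_
          have hk : 0 < K ^ k := pow_pos hK k
          have h4 : C * K ^ k ≤ ((k : ℝ) + 1) * (C * L * K ^ k) := by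
            have : C * K ^ k ≤ C * L * K ^ k := by
              have : C * 1 ≤ C * L := by gcongr
              nlinarith
            have h5 : 0 ≤ (k : ℝ) * (C * L * K ^ k) := by positivity
            linarith
          have h6 : 2 * (C * L * K ^ k) ≤ L * K ^ (k + 1) := by
            rw [pow_succ]
            have : 0 < L * K ^ k := by positivity
            nlinarith
          nlinarith [(Nat.cast_nonneg k : (0 : ℝ) ≤ k)]
        exact le_of_mul_le_mul_left h3 (by positivity)
  set ρ := min ρ1 (1 / (2 * K))
  have hρ : 0 < ρ := lt_min hρ1 (by positivity)
  have hρK : ρ * K ≤ 1 / 2 := by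
    have : ρ ≤ 1 / (2 * K) := min_le_right _ _
    calc ρ * K ≤ 1 / (2 * K) * K := by gcongr
      _ = 1 / 2 := by field_simp
  let U : ℂ → E := fun z => ∑' n, z ^ n • c n
  have hgeo : ∀ z ∈ ball (0 : ℂ) ρ, ∀ (M : ℝ), Summable (fun n : ℕ => M * K ^ n * ‖z‖ ^ n) := by
    intro z hz M
    have hz' : ‖z‖ < ρ := by simpa using hz
    have h1 : K * ‖z‖ < 1 := by nlinarith
    have := (summable_geometric_of_lt_one (by positivity) h1).mul_left M
    refine this.congr fun n => ?_
    rw [mul_pow]; ring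
  have hUd : ∀ z ∈ ball (0 : ℂ) ρ, HasDerivAt U (A (x0 + z) (U z) + b (x0 + z)) z := by
    intro z hz
    have hzρ : ‖z‖ < ρ := by simpa using hz
    have hS := hsum z (ball_subset_ball (min_le_left _ _) hz)
    have h1 : HasDerivAt U (∑' n : ℕ, ((n : ℂ) * z ^ (n - 1)) • c n) z :=
      aux_series_deriv c L K ρ hK hρ hρK hcb z hz
    have hsf : Summable fun n => ‖z ^ n • q.coeff n‖ := by
      refine Summable.of_nonneg_of_le (fun _ => norm_nonneg _) (fun n => ?_) (hgeo z hz C)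
      rw [norm_smul, norm_pow, mul_comm]
      gcongr
      exact hAK n
    have hsg : Summable fun n => ‖z ^ n • c n‖ := by
      refine Summable.of_nonneg_of_le (fun _ => norm_nonneg _) (fun n => ?_) (hgeo z hz L)
      rw [norm_smul, norm_pow, mul_comm]
      gcongr
      exact hcb n
    have hterm : ∀ n : ℕ, (((n + 1 : ℕ) : ℂ) * z ^ (n + 1 - 1)) • c (n + 1) =
        ∑ p ∈ Finset.HasAntidiagonal.antidiagonal n, (z ^ p.2 • q.coeff p.2) (z ^ p.1 • c p.1) + z ^ n • p.coeff n := by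
      intro n
      have : (((n + 1 : ℕ) : ℂ) * z ^ (n + 1 - 1)) • c (n + 1) = z ^ n • (((n : ℂ) + 1) • c (n + 1)) := by
        rw [smul_smul, Nat.add_sub_cancel]; push_cast; ring_nf
      rw [this, hcs, smul_add, Finset.smul_sum]
      congr 1
      refine Finset.sum_congr rfl fun i hi => ?_
      have hik := Finset.HasAntidiagonal.mem_antidiagonal.1 hi
      rw [_root_.smul_apply, map_smul, smul_smul, ← pow_add, add_comm, hik]
    obtain ⟨hcau, hcs2⟩ := aux_cauchy _ _ hsf hsg
    have h2 : ∑' n : ℕ, ((n : ℂ) * z ^ (n - 1)) • c n = A (x0 + z) (U z) + b (x0 + z) := by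
      have hshift : Summable fun n : ℕ => (((n + 1 : ℕ) : ℂ) * z ^ (n + 1 - 1)) • c (n + 1) := by
        simp_rw [hterm]
        exact hcs2.add hS.2.summable
      rw [((summable_nat_add_iff 1 (f := fun n : ℕ => ((n : ℂ) * z ^ (n - 1)) • c n)).1 hshift).tsum_eq_zero_add]
      simp_rw [hterm]
      rw [hcs2.tsum_add hS.2.summable, hcau, hS.1.tsum_eq, hS.2.tsum_eq]
      simp [U]
    rw [← h2]
    exact h1
  refine ⟨ρ, hρ, fun x => U (x - x0), ?_, fun x hx => ?_⟩
  · simp only [sub_self, U]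
    rw [tsum_eq_single 0]
    · simp [hc0]
    · intro n hn; simp [hn]
  · have h1 := hUd (x - x0) (by simpa [dist_eq_norm] using hx)
    have h2 := h1.comp_sub_const x x0
    simpa using h2

theorem aux_ode_local (A : ℂ → E →L[ℂ] E) (b : ℂ → E) (x0 : ℂ) (hA : AnalyticAt ℂ A x0)
    (hb : AnalyticAt ℂ b x0) :
    ∃ ρ > 0, ∀ v ∈ ball x0 ρ, ∀ a : E, ∃ u : ℂ → E, u v = a ∧
      ∀ x ∈ ball x0 ρ, HasDerivAt u (A x (u x) + b x) x := by
  obtain ⟨ρ1, hρ1, u, -, hu⟩ := aux_ode_exists A b x0 hA hb 0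
  have hA2 : AnalyticAt ℂ (fun x => ContinuousLinearMap.compL ℂ E E E (A x)) x0 :=
    (ContinuousLinearMap.analyticAt _ _).comp hA
  obtain ⟨ρ2, hρ2, M, hM0, hM⟩ := aux_ode_exists (E := E →L[ℂ] E)
    (fun x => ContinuousLinearMap.compL ℂ E E E (A x)) (fun _ => 0) x0 hA2 analyticAt_const 1
  have hMc : ContinuousAt M x0 := (hM x0 (mem_ball_self hρ2)).continuousAt
  have hunit : ∀ᶠ x in 𝓝 x0, IsUnit (M x) := by
    have h0 : {m : E →L[ℂ] E | IsUnit m} ∈ 𝓝 (M x0) := by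
      rw [hM0]
      exact Units.isOpen.mem_nhds isUnit_one
    exact hMc h0
  obtain ⟨ρ3, hρ3, h3⟩ := Metric.eventually_nhds_iff_ball.1 hunit
  refine ⟨min ρ1 (min ρ2 ρ3), by positivity, fun v hv a => ?_⟩
  have hv3 : v ∈ ball x0 ρ3 := ball_subset_ball ((min_le_right _ _).trans (min_le_right _ _)) hv
  obtain ⟨m, hm⟩ := h3 v hv3
  let w : E := (↑m⁻¹ : E →L[ℂ] E) (a - u v)
  refine ⟨fun x => u x + M x w, ?_, fun x hx => ?_⟩
  · have : M v w = a - u v := by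
      have : (M v * ↑m⁻¹) (a - u v) = a - u v := by rw [← hm, m.mul_inv]; rfl
      exact this
    change u v + M v w = a
    rw [this]; abel
  · have h1 := hu x (ball_subset_ball (min_le_left _ _) hx)
    have h2 := hM x (ball_subset_ball ((min_le_right _ _).trans (min_le_left _ _)) hx)
    have h4 := h1.add (h2.clm_apply (hasDerivAt_const x w))
    have e : A x (u x + M x w) + b x = (A x (u x) + b x) +
        ((ContinuousLinearMap.compL ℂ E E E (A x) (M x) + 0) w + M x 0) := by
      rw [add_zero, map_zero, add_zero, map_add, ContinuousLinearMap.compL_apply,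
        ContinuousLinearMap.comp_apply]
      abel
    change HasDerivAt _ (A x (u x + M x w) + b x) x
    rw [e]
    exact h4

end ODE
section Entire
variable {E : Type*} [NormedAddCommGroup E] [NormedSpace ℂ E]

/-- `f` is the sum of the everywhere convergent power series with coefficients `c`. -/
def AuxPS (f : ℂ → E) (c : ℕ → E) : Prop := ∀ x : ℂ, HasSum (fun n => x ^ n • c n) (f x)

theorem AuxPS.unique {f : ℂ → E} {c d : ℕ → E} (hc : AuxPS f c) (hd : AuxPS f d) : c = d := by
  let q : (ℕ → E) → FormalMultilinearSeries ℂ ℂ E :=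
    fun c n => ContinuousMultilinearMap.mkPiRing ℂ (Fin n) (c n)
  have h : ∀ c : ℕ → E, AuxPS f c → HasFPowerSeriesAt f (q c) 0 := by
    intro c hc
    refine hasFPowerSeriesAt_iff.2 ?_
    refine Eventually.of_forall fun z => ?_
    simpa [q, FormalMultilinearSeries.coeff] using hc z
  have := (h c hc).eq_formalMultilinearSeries (h d hd)
  funext n
  have h2 := congrArg (fun q : FormalMultilinearSeries ℂ ℂ E => q.coeff n) this
  simpa [q, FormalMultilinearSeries.coeff] using h2

theorem AuxPS.pow_mul {f : ℂ → E} {c : ℕ → E} (hc : AuxPS f c) (i : ℕ) :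
    AuxPS (fun x => x ^ i • f x) (fun n => if i ≤ n then c (n - i) else 0) := by
  intro x
  rw [← (add_left_injective i).hasSum_iff]
  · convert (hc x).const_smul (x ^ i) using 2 with n
    simp [pow_add, smul_smul, mul_comm]
  · intro n hn
    have : ¬ i ≤ n := fun h => hn ⟨n - i, by simp; omega⟩
    simp [this]

theorem AuxPS.sum {ι : Type*} (s : Finset ι) (f : ι → ℂ → E) (c : ι → ℕ → E)
    (h : ∀ i ∈ s, AuxPS (f i) (c i)) :
    AuxPS (fun x => ∑ i ∈ s, f i x) (fun n => ∑ i ∈ s, c i n) := by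
  intro x
  simp only [Finset.smul_sum]
  exact hasSum_sum fun i hi => h i hi x

theorem AuxPS.add {f g : ℂ → E} {c d : ℕ → E} (hc : AuxPS f c) (hd : AuxPS g d) :
    AuxPS (fun x => f x + g x) (fun n => c n + d n) := by
  intro x
  simp only [smul_add]
  exact (hc x).add (hd x)

theorem AuxPS.clm {f : ℂ → E} {c : ℕ → E} (hc : AuxPS f c) (T : E →L[ℂ] E) :
    AuxPS (fun x => T (f x)) (fun n => T (c n)) := by
  intro x
  have := (hc x).mapL T
  simpa using this

theorem AuxPS.poly {f : ℂ → E} {c : ℕ → E} (hc : AuxPS f c) (q : Polynomial ℂ) (d : ℕ)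
    (hd : q.natDegree < d) :
    AuxPS (fun x => q.eval x • f x)
      (fun n => ∑ i ∈ Finset.range d, q.coeff i • if i ≤ n then c (n - i) else 0) := by
  have h := AuxPS.sum (Finset.range d) _ _ (fun i _ => (hc.pow_mul i).clm (q.coeff i • ContinuousLinearMap.id ℂ E))
  convert h using 2 with x
  · rw [Polynomial.eval_eq_sum_range' hd, Finset.sum_smul]
    refine Finset.sum_congr rfl fun i _ => ?_
    rw [mul_smul]
    rfl
  · rfl

theorem aux_coef_zero (c : ℕ → E) (h : ∀ ε : ℝ, 0 < ε → ∃ a : ℝ, 0 ≤ a ∧ ∀ m, ‖c m‖ ≤ a * ε ^ m)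
    (K : ℝ) (hK : 0 ≤ K) (hr : ∀ ε : ℝ, 0 < ε → ε ≤ 1 → ∀ a : ℝ, 0 ≤ a → (∀ m, ‖c m‖ ≤ a * ε ^ m) →
      ∀ n, ‖c n‖ ≤ K * a * ε ^ (n + 1)) (n : ℕ) : c n = 0 := by
  set ε : ℝ := 1 / (2 * (K + 1)) with hε
  have he : 0 < ε := by positivity
  have he1 : ε ≤ 1 := by rw [hε, div_le_one (by positivity)]; linarith
  have hKe : K * ε ≤ 1 / 2 := by
    have : (K + 1) * ε = 1 / 2 := by rw [hε]; field_simp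
    nlinarith
  obtain ⟨a, ha, hb⟩ := h ε he
  have hk : ∀ k : ℕ, ∀ m, ‖c m‖ ≤ (a * (1 / 2) ^ k) * ε ^ m := by
    intro k
    induction k with
    | zero => simpa using hb
    | succ k ih =>
      intro m
      refine (hr ε he he1 _ (by positivity) ih m).trans ?_
      have : 0 ≤ a * (1 / 2) ^ k * ε ^ m := by positivity
      calc K * (a * (1 / 2) ^ k) * ε ^ (m + 1) = (K * ε) * (a * (1 / 2) ^ k * ε ^ m) := by ring
        _ ≤ (1 / 2) * (a * (1 / 2) ^ k * ε ^ m) := by gcongr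
        _ = _ := by ring
  have ht : Tendsto (fun k : ℕ => (a * (1 / 2 : ℝ) ^ k) * ε ^ n) atTop (𝓝 0) := by
    have := ((tendsto_pow_atTop_nhds_zero_of_lt_one (r := (1 / 2 : ℝ)) (by norm_num) (by norm_num)).const_mul a).mul_const (ε ^ n)
    simpa using this
  have := ge_of_tendsto' ht (fun k => hk k n)
  simpa using this

theorem aux_inv_bound (T : E →L[ℂ] E) (hT : ∀ n : ℕ, ∃ C : ℝ, ∀ v, ‖v‖ ≤ C * ‖(n : ℂ) • v + T v‖) :
    ∃ C : ℝ, 0 ≤ C ∧ ∀ (n : ℕ) v, ((n : ℝ) + 1) * ‖v‖ ≤ C * ‖(n : ℂ) • v + T v‖ := by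
  choose C hC using hT
  obtain ⟨N0, hN0⟩ := exists_nat_ge (2 * ‖T‖ + 1)
  have hnn : ∀ n ∈ Finset.range N0, 0 ≤ ((n : ℝ) + 1) * |C n| := fun n _ => by positivity
  have hs := Finset.sum_nonneg hnn
  refine ⟨4 + ∑ n ∈ Finset.range N0, ((n : ℝ) + 1) * |C n|, by linarith, fun n v => ?_⟩
  by_cases hn : n < N0
  · have h1 := Finset.single_le_sum hnn (Finset.mem_range.2 hn)
    have h2 := hC n v
    calc ((n : ℝ) + 1) * ‖v‖ ≤ ((n : ℝ) + 1) * (|C n| * ‖(n : ℂ) • v + T v‖) := by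
          gcongr
          exact h2.trans (by gcongr; exact le_abs_self _)
      _ = ((n : ℝ) + 1) * |C n| * ‖(n : ℂ) • v + T v‖ := by ring
      _ ≤ _ := by gcongr; linarith
  · have hn' : (N0 : ℝ) ≤ n := by exact_mod_cast not_lt.1 hn
    have h1 : (n : ℝ) * ‖v‖ ≤ ‖(n : ℂ) • v + T v‖ + ‖T‖ * ‖v‖ := by
      have h2 : ‖(n : ℂ) • v‖ = n * ‖v‖ := by rw [norm_smul, Complex.norm_natCast]
      rw [← h2]
      have h3 : (n : ℂ) • v = ((n : ℂ) • v + T v) - T v := by abel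
      calc ‖(n : ℂ) • v‖ = ‖((n : ℂ) • v + T v) - T v‖ := by rw [← h3]
        _ ≤ _ := norm_sub_le _ _
        _ ≤ _ := by gcongr; exact T.le_opNorm v
    have hv := norm_nonneg v
    have hw := norm_nonneg ((n : ℂ) • v + T v)
    have h4 : (2 * ‖T‖ + 1) * ‖v‖ ≤ n * ‖v‖ := by gcongr; linarith
    have h5 : (n + 1) * ‖v‖ ≤ 4 * ‖(n : ℂ) • v + T v‖ := by nlinarith [norm_nonneg T]
    refine h5.trans ?_
    gcongr
    linarith

theorem aux_entire_zero [CompleteSpace E] (S : ℕ) (Q : Polynomial ℂ) (hQ : Q.Monic) (hQd : Q.natDegree = S + 2)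
    {ι : Type*} [Fintype ι] (R : ι → Polynomial ℂ) (hR : ∀ j, (R j).Monic)
    (hRd : ∀ j, (R j).natDegree = S + 1) (B : ι → E →L[ℂ] E)
    (hinv : ∀ n : ℕ, ∃ C : ℝ, ∀ v, ‖v‖ ≤ C * ‖(n : ℂ) • v + (∑ j, B j) v‖)
    (f : ℕ → E) (Y : ℂ → E) (hY : Differentiable ℂ Y)
    (hode : ∀ x, Q.eval x • deriv Y x + ∑ j, (R j).eval x • B j (Y x) =
      ∑ n ∈ Finset.range (S + 1), x ^ n • f n) : ∀ x, Y x = 0 := by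
  have hE : ∀ Z : ℂ → E, Differentiable ℂ Z →
      AuxPS Z (fun n => ((n.factorial : ℂ))⁻¹ • iteratedDeriv n Z 0) := by
    intro Z hZ x
    have := Complex.hasSum_taylorSeries_of_entire hZ 0 x
    refine this.congr_fun ?_
    intro n
    simp [smul_smul, mul_comm]
  set c : ℕ → E := fun n => ((n.factorial : ℂ))⁻¹ • iteratedDeriv n Y 0 with hc
  have hYc : AuxPS Y c := hE Y hY
  have hdY : AuxPS (deriv Y) (fun n => ((n : ℂ) + 1) • c (n + 1)) := by
    have := hE (deriv Y) hY.deriv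
    convert this using 2 with n
    rw [hc]
    simp only
    rw [iteratedDeriv_succ', smul_smul]
    congr 1
    rw [Nat.factorial_succ]
    push_cast
    have : ((n : ℂ) + 1) ≠ 0 := by exact_mod_cast Nat.succ_ne_zero n
    have h2 : (n.factorial : ℂ) ≠ 0 := by exact_mod_cast n.factorial_ne_zero
    field_simp
  clear_value c
  have h1 := (hdY.poly Q (S + 3) (by omega)).add
    (AuxPS.sum Finset.univ _ _ (fun j _ => (hYc.clm (B j)).poly (R j) (S + 2) (by rw [hRd]; omega)))
  have h2 : AuxPS (fun x : ℂ => ∑ n ∈ Finset.range (S + 1), x ^ n • f n)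
      (fun n => if n < S + 1 then f n else 0) := by
    intro x
    have := hasSum_sum_of_ne_finset_zero (L := SummationFilter.unconditional ℕ) (f := fun n : ℕ => x ^ n • if n < S + 1 then f n else 0)
      (s := Finset.range (S + 1)) (by
        intro n hn
        have : ¬ n < S + 1 := by simpa using hn
        simp [this])
    convert this using 1
    refine Finset.sum_congr rfl fun n hn => ?_
    simp [Finset.mem_range.1 hn]
  have h3 := (show AuxPS _ _ from by
    have : (fun x => Q.eval x • deriv Y x + ∑ j, (R j).eval x • B j (Y x)) =
      fun x : ℂ => ∑ n ∈ Finset.range (S + 1), x ^ n • f n := funext hode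
    rw [← this] at h2
    exact h2).unique h1
  have hrec : ∀ n : ℕ, (n : ℂ) • c n + (∑ j, B j) (c n) =
      -(∑ i ∈ Finset.range (S + 2), Q.coeff i • ((n + S + 2 - i : ℕ) : ℂ) • c (n + S + 2 - i) +
        ∑ j, ∑ i ∈ Finset.range (S + 1), (R j).coeff i • B j (c (n + S + 1 - i))) := by
    intro n
    have h4 := congrFun h3 (n + S + 1)
    rw [if_neg (by omega)] at h4
    rw [Finset.sum_range_succ _ (S + 2)] at h4
    have e1 : (Q.coeff (S + 2) • if S + 2 ≤ n + S + 1 then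
        (((n + S + 1 - (S + 2) : ℕ) : ℂ) + 1) • c (n + S + 1 - (S + 2) + 1) else 0) = (n : ℂ) • c n := by
      rw [← hQd, hQ.coeff_natDegree, one_smul, hQd]
      cases n with
      | zero => simp
      | succ n =>
        rw [if_pos (by omega), show n + 1 + S + 1 - (S + 2) = n by omega]
        push_cast
        rfl
    have e2 : ∑ j, ((R j).coeff (S + 1) • if S + 1 ≤ n + S + 1 then
        B j (c (n + S + 1 - (S + 1))) else 0) = (∑ j, B j) (c n) := by
      rw [_root_.sum_apply]
      refine Finset.sum_congr rfl fun j _ => ?_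
      rw [← hRd j, (hR j).coeff_natDegree, one_smul, hRd j, if_pos (by omega),
        show n + S + 1 - (S + 1) = n by omega]
    have e3 : ∑ i ∈ Finset.range (S + 2), (Q.coeff i • if i ≤ n + S + 1 then
        (((n + S + 1 - i : ℕ) : ℂ) + 1) • c (n + S + 1 - i + 1) else 0) =
        ∑ i ∈ Finset.range (S + 2), Q.coeff i • ((n + S + 2 - i : ℕ) : ℂ) • c (n + S + 2 - i) := by
      refine Finset.sum_congr rfl fun i hi => ?_
      have := Finset.mem_range.1 hi
      rw [if_pos (by omega), show n + S + 2 - i = n + S + 1 - i + 1 by omega]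
      push_cast
      rfl
    have e4 : ∑ j, ∑ i ∈ Finset.range (S + 1), ((R j).coeff i • if i ≤ n + S + 1 then
        B j (c (n + S + 1 - i)) else 0) =
        ∑ j, ∑ i ∈ Finset.range (S + 1), (R j).coeff i • B j (c (n + S + 1 - i)) := by
      refine Finset.sum_congr rfl fun j _ => Finset.sum_congr rfl fun i hi => ?_
      have := Finset.mem_range.1 hi
      rw [if_pos (by omega)]
    have e5 : ∑ j, ∑ i ∈ Finset.range (S + 2), ((R j).coeff i • if i ≤ n + S + 1 then
        B j (c (n + S + 1 - i)) else 0) =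
        ∑ j, ∑ i ∈ Finset.range (S + 1), (R j).coeff i • B j (c (n + S + 1 - i)) +
        (∑ j, B j) (c n) := by
      rw [← e4, ← e2, ← Finset.sum_add_distrib]
      exact Finset.sum_congr rfl fun j _ => Finset.sum_range_succ _ (S + 1)
    rw [e1, e3, e5] at h4
    rw [eq_neg_iff_add_eq_zero]
    rw [h4]
    abel
  obtain ⟨C, hC, hCb⟩ := aux_inv_bound _ hinv
  set K0 : ℝ := ∑ i ∈ Finset.range (S + 2), ‖Q.coeff i‖ * (S + 2) +
    ∑ j, ∑ i ∈ Finset.range (S + 1), ‖(R j).coeff i‖ * ‖B j‖ with hK0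
  have hK0n : 0 ≤ K0 := by positivity
  have hc0 : ∀ n, c n = 0 := by
    refine aux_coef_zero c ?_ (C * K0) (by positivity) ?_
    · intro ε hε
      have hs := (hYc ((ε : ℂ)⁻¹)).summable.tendsto_atTop_zero
      obtain ⟨a, ha⟩ := (hs.norm.bddAbove_range)
      refine ⟨max a 0, le_max_right _ _, fun m => ?_⟩
      have h5 := ha ⟨m, rfl⟩
      simp only [norm_smul, norm_pow, norm_inv, Complex.norm_real, Real.norm_eq_abs, abs_of_pos hε] at h5
      rw [inv_pow, inv_mul_le_iff₀ (by positivity)] at h5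
      rw [mul_comm]
      refine h5.trans ?_
      gcongr
      exact le_max_left _ _
    · intro ε hε hε1 a ha hb n
      have hmono : ∀ m, n + 1 ≤ m → ‖c m‖ ≤ a * ε ^ (n + 1) := fun m hm =>
        (hb m).trans (by gcongr ?_ * ?_; exact pow_le_pow_of_le_one hε.le hε1 hm)
      have h6 : ‖(n : ℂ) • c n + (∑ j, B j) (c n)‖ ≤ K0 * (n + 1) * (a * ε ^ (n + 1)) := by
        rw [hrec, norm_neg, hK0, add_mul, add_mul]
        refine (norm_add_le _ _).trans (add_le_add ?_ ?_)
        · rw [Finset.sum_mul, Finset.sum_mul]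
          refine norm_sum_le_of_le _ fun i hi => ?_
          have := Finset.mem_range.1 hi
          rw [norm_smul, norm_smul, Complex.norm_natCast, mul_assoc, mul_assoc]
          have h7 : ((n + S + 2 - i : ℕ) : ℝ) ≤ (S + 2) * (n + 1) := by
            have : n + S + 2 - i ≤ (S + 2) * (n + 1) := (Nat.sub_le _ _).trans (by nlinarith)
            exact_mod_cast this
          rw [← mul_assoc ((S : ℝ) + 2)]
          gcongr
          exact hmono _ (by omega)
        · rw [Finset.sum_mul, Finset.sum_mul]
          refine norm_sum_le_of_le _ fun j _ => ?_
          rw [Finset.sum_mul, Finset.sum_mul]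
          refine norm_sum_le_of_le _ fun i hi => ?_
          have := Finset.mem_range.1 hi
          rw [norm_smul, mul_assoc, mul_assoc]
          gcongr
          refine ((B j).le_opNorm _).trans ?_
          gcongr
          have h8 := hmono (n + S + 1 - i) (by omega)
          have h9 : 0 ≤ (n : ℝ) * (a * ε ^ (n + 1)) := by positivity
          linarith
      have h7 := hCb n (c n)
      have h8 : ((n : ℝ) + 1) * ‖c n‖ ≤ ((n : ℝ) + 1) * (C * K0 * a * ε ^ (n + 1)) := by
        refine h7.trans ?_
        calc _ ≤ C * (K0 * (n + 1) * (a * ε ^ (n + 1))) := by gcongr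
          _ = _ := by ring
      exact le_of_mul_le_mul_left h8 (by positivity)
  intro x
  have := hYc x
  simp only [hc0, smul_zero] at this
  exact this.unique hasSum_zero
end Entire

section Assembly
variable {E : Type*} [NormedAddCommGroup E] [NormedSpace ℂ E] [CompleteSpace E]

theorem aux_global (D : Set ℂ) (hD : IsOpen D) (hc : IsPreconnected D) (P : Finset ℂ) (x0 : ℂ)
    (hx0 : x0 ∈ D) (hP : ∀ x ∈ P, x ∈ D) (A : ℂ → E →L[ℂ] E) (b : ℂ → E)
    (hA : ∀ x ∉ P, AnalyticAt ℂ A x) (hb : ∀ x ∉ P, AnalyticAt ℂ b x) (y : ℂ → E)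
    (hy : DifferentiableOn ℂ y D) (hode : ∀ x ∈ D, x ∉ P → HasDerivAt y (A x (y x) + b x) x) :
    ∃ Y : ℂ → E, Differentiable ℂ Y ∧ (∀ x ∉ P, HasDerivAt Y (A x (Y x) + b x) x) ∧
      ∃ U : Set ℂ, IsOpen U ∧ U.Nonempty ∧ U ⊆ D ∧ EqOn Y y U := by
  obtain ⟨r, hr, hrD⟩ := Metric.isOpen_iff.1 hD x0 hx0
  obtain ⟨Φ, hΦ, hΦP⟩ := aux_collect D hD hc x0 r hr hrD P hP
  have hsymmD : ∀ w ∈ D, Φ.symm w ∈ D := by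
    intro w hw
    by_contra h
    have := hΦ _ h
    rw [Φ.apply_symm_apply] at this
    rw [← this] at h
    exact h hw
  let P' : Set ℂ := Φ '' (P : Set ℂ)
  have hP' : ∀ w, w ∈ P' ↔ Φ.symm w ∈ P := by
    intro w
    constructor
    · rintro ⟨x, hx, rfl⟩
      simpa using hx
    · intro h
      exact ⟨Φ.symm w, h, by simp⟩
  let G : (ℂ → E) → ℂ → Prop := fun s w =>
    ∀ᶠ x in 𝓝 (Φ.symm w), HasDerivAt (s ∘ Φ) (A x (s (Φ x)) + b x) x
  have hPo : ∀ x ∉ P, ∀ᶠ z in 𝓝 x, z ∉ P := fun x hx =>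
    P.finite_toSet.isClosed.isOpen_compl.mem_nhds hx
  obtain ⟨s, hs0, hsG⟩ := aux_extend P' (P.finite_toSet.image _) G x0 r hr
    (by rintro _ ⟨x, hx, rfl⟩; exact hΦP x hx)
    (by
      intro s s' w hss hG
      have hcont : Tendsto Φ (𝓝 (Φ.symm w)) (𝓝 w) := by
        have := Φ.continuous.tendsto (Φ.symm w)
        rwa [Φ.apply_symm_apply] at this
      have h1 : ∀ᶠ x in 𝓝 (Φ.symm w), (s ∘ Φ) x = (s' ∘ Φ) x := hcont.eventually hss
      change ∀ᶠ x in 𝓝 (Φ.symm w), HasDerivAt (s' ∘ Φ) (A x (s' (Φ x)) + b x) x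
      filter_upwards [hG, h1, h1.eventually_nhds] with x hx h2 h3
      have h2' : s (Φ x) = s' (Φ x) := h2
      rw [← h2']
      exact hx.congr_of_eventuallyEq (EventuallyEq.symm h3))
    (by
      intro W hW hWc hWP s s' hs hs' v hv hvv
      have key := aux_ode_unique (Φ ⁻¹' W) (hW.preimage Φ.continuous)
        (by
          rw [← Φ.image_symm]
          exact hWc.image _ Φ.symm.continuous.continuousOn) A
        (fun x hx => (hA x (fun hxP => hWP _ hx ⟨x, hxP, rfl⟩)).continuousAt.continuousWithinAt) b
        (s ∘ Φ) (s' ∘ Φ)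
        (fun x hx => by
          have := (hs _ hx).self_of_nhds
          simpa using this)
        (fun x hx => by
          have := (hs' _ hx).self_of_nhds
          simpa using this) (Φ.symm v) (by simpa using hv) (by simpa using hvv)
      intro w hw
      have := key (show Φ.symm w ∈ Φ ⁻¹' W by simpa using hw)
      simpa using this)
    (by
      intro w hw
      have hw' : Φ.symm w ∉ P := fun h => hw ((hP' w).2 h)
      obtain ⟨ρ, hρ, hloc⟩ := aux_ode_local A b (Φ.symm w) (hA _ hw') (hb _ hw')
      have h1 : ∀ᶠ z in 𝓝 w, Φ.symm z ∈ ball (Φ.symm w) ρ ∧ Φ.symm z ∉ P :=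
        (Φ.symm.continuous.tendsto w).eventually (Filter.Eventually.and (ball_mem_nhds _ hρ) (hPo _ hw'))
      obtain ⟨ρ', hρ', h2⟩ := Metric.eventually_nhds_iff_ball.1 h1
      refine ⟨ρ', hρ', fun z hz hzP => (h2 z hz).2 ((hP' z).1 hzP), fun v hv a => ?_⟩
      obtain ⟨u, hu, hud⟩ := hloc (Φ.symm v) (h2 v hv).1 a
      refine ⟨u ∘ Φ.symm, hu, fun z hz => ?_⟩
      have e : (u ∘ Φ.symm) ∘ Φ = u := by funext x; simp
      change ∀ᶠ x in 𝓝 (Φ.symm z), HasDerivAt ((u ∘ Φ.symm) ∘ Φ) (A x ((u ∘ Φ.symm) (Φ x)) + b x) x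
      filter_upwards [isOpen_ball.mem_nhds (h2 z hz).1] with x hx
      rw [e]
      simpa using hud x hx)
    (y ∘ Φ.symm)
    (by
      intro z hz
      have hzD := hsymmD z (hrD hz.1)
      have hzP : Φ.symm z ∉ P := fun h => hz.2 ((hP' z).2 h)
      have e : (y ∘ Φ.symm) ∘ Φ = y := by funext x; simp
      change ∀ᶠ x in 𝓝 (Φ.symm z), HasDerivAt ((y ∘ Φ.symm) ∘ Φ) (A x ((y ∘ Φ.symm) (Φ x)) + b x) x
      filter_upwards [hD.mem_nhds hzD, hPo _ hzP] with x hx hxP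
      rw [e]
      simpa using hode x hx hxP)
  have hYo : ∀ x ∉ P, HasDerivAt (s ∘ Φ) (A x ((s ∘ Φ) x) + b x) x := by
    intro x hx
    have := (hsG (Φ x) (fun h => hx (by simpa using (hP' _).1 h))).self_of_nhds
    simpa using this
  have hU : IsOpen (Φ ⁻¹' ball x0 r) := isOpen_ball.preimage Φ.continuous
  have hUD : Φ ⁻¹' ball x0 r ⊆ D := by
    intro x hx
    have := hsymmD _ (hrD hx)
    simpa using this
  have hUe : EqOn (s ∘ Φ) y (Φ ⁻¹' ball x0 r) := by
    intro x hx
    have := hs0 hx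
    simpa using this
  refine ⟨s ∘ Φ, fun x => ?_, hYo, Φ ⁻¹' ball x0 r, hU, ⟨Φ.symm x0, by simpa using hr⟩, hUD, hUe⟩
  by_cases hx : x ∈ P
  · have hxU : x ∈ Φ ⁻¹' ball x0 r := hΦP x hx
    have h1 : DifferentiableAt ℂ y x := hy.differentiableAt (hD.mem_nhds (hUD hxU))
    exact h1.congr_of_eventuallyEq (eventually_of_mem (hU.mem_nhds hxU) hUe)
  · exact (hYo x hx).differentiableAt

end Assembly

end Aux

open Filter Topology Metric in
theorem aux_main (N S : ℕ)
    (p : Fin (S + 2) → ℂ)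
    (B : Fin (S + 2) → Matrix (Fin N) (Fin N) ℂ)
    (hinv : ∀ k : ℕ, IsUnit ((k : ℂ) • (1 : Matrix (Fin N) (Fin N) ℂ) + ∑ j, B j))
    (D : Set ℂ) (hD : IsOpen D) (hDconn : IsPreconnected D) (hpD : ∀ j, p j ∈ D)
    (φ : Fin N → Polynomial ℂ) (hφ : ∀ i, (φ i).degree ≤ (S : ℕ))
    (y : ℂ → Fin N → ℂ) (hya : AnalyticOnNhd ℂ y D)
    (hy : ∀ x ∈ D \ Set.range p,
      HasDerivAt y ((∏ j, (x - p j))⁻¹ • (fun i => (φ i).eval x)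
          - (∑ j, (x - p j)⁻¹ • B j) *ᵥ y x) x) :
    φ = 0 ∧ ∀ x ∈ D, y x = 0 := by
  classical
  let T : Matrix (Fin N) (Fin N) ℂ → ((Fin N → ℂ) →L[ℂ] (Fin N → ℂ)) := fun M =>
    LinearMap.toContinuousLinearMap M.mulVecLin
  have hT : ∀ M v, T M v = M *ᵥ v := fun M v => rfl
  let f : ℕ → Fin N → ℂ := fun n i => (φ i).coeff n
  have hf : ∀ x : ℂ, (fun i => (φ i).eval x) = ∑ n ∈ Finset.range (S + 1), x ^ n • f n := by
    intro x
    funext i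
    have hd : (φ i).natDegree < S + 1 :=
      Nat.lt_succ_of_le (Polynomial.natDegree_le_of_degree_le (hφ i))
    rw [Polynomial.eval_eq_sum_range' hd, Finset.sum_apply]
    refine Finset.sum_congr rfl fun n _ => ?_
    simp [f, mul_comm]
  let A : ℂ → ((Fin N → ℂ) →L[ℂ] (Fin N → ℂ)) := fun x => -∑ j, (x - p j)⁻¹ • T (B j)
  let b : ℂ → Fin N → ℂ := fun x => (∏ j, (x - p j))⁻¹ • ∑ n ∈ Finset.range (S + 1), x ^ n • f n
  let P : Finset ℂ := Finset.univ.image p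
  have hP : ∀ x, x ∉ P → ∀ j, x - p j ≠ 0 := by
    intro x hx j h
    exact hx (Finset.mem_image.2 ⟨j, Finset.mem_univ _, (sub_eq_zero.1 h).symm⟩)
  have hAe : ∀ x v, A x v = -((∑ j, (x - p j)⁻¹ • B j) *ᵥ v) := by
    intro x v
    simp only [A, _root_.neg_apply, _root_.sum_apply, _root_.smul_apply, hT]
    rw [Matrix.sum_mulVec]
    simp only [Matrix.smul_mulVec]
  have hA : ∀ x ∉ P, AnalyticAt ℂ A x := by
    intro x hx
    refine AnalyticAt.neg (Finset.analyticAt_fun_sum _ fun j _ => ?_)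
    exact ((analyticAt_id.sub analyticAt_const).inv (hP x hx j)).smul analyticAt_const
  have hb : ∀ x ∉ P, AnalyticAt ℂ b x := by
    intro x hx
    refine AnalyticAt.smul (𝕜 := ℂ) (AnalyticAt.inv (𝕜 := ℂ) (𝕝 := ℂ) (f := fun x => ∏ j, (x - p j)) ?_
      (Finset.prod_ne_zero_iff.2 fun j _ => hP x hx j)) ?_
    · exact Finset.analyticAt_fun_prod _ fun j _ => analyticAt_id.sub analyticAt_const
    · exact Finset.analyticAt_fun_sum _ fun n _ => (analyticAt_id.pow n).smul analyticAt_const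
  obtain ⟨Y, hYd, hYo, U, hU, ⟨u, hu⟩, hUD, hUe⟩ := aux_global D hD hDconn P (p 0) (hpD 0)
    (by intro x hx; obtain ⟨j, -, rfl⟩ := Finset.mem_image.1 hx; exact hpD j) A b hA hb y
    hya.differentiableOn (by
      intro x hx hxP
      have h := hy x ⟨hx, by rintro ⟨j, rfl⟩; exact hxP (Finset.mem_image_of_mem p (Finset.mem_univ j))⟩
      have e : A x (y x) + b x = (∏ j, (x - p j))⁻¹ • (fun i => (φ i).eval x)
          - (∑ j, (x - p j)⁻¹ • B j) *ᵥ y x := by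
        rw [hAe, hf]
        simp only [b]
        abel
      rw [e]
      exact h)
  let Q : Polynomial ℂ := ∏ j, (Polynomial.X - Polynomial.C (p j))
  let R : Fin (S + 2) → Polynomial ℂ := fun j =>
    ∏ i ∈ Finset.univ.erase j, (Polynomial.X - Polynomial.C (p i))
  have hQe : ∀ x, Q.eval x = ∏ j, (x - p j) := by intro x; simp [Q, Polynomial.eval_prod]
  have hRe : ∀ j x, (R j).eval x = ∏ i ∈ Finset.univ.erase j, (x - p i) := by
    intro j x; simp [R, Polynomial.eval_prod]
  have hYc : Continuous (deriv Y) := hYd.deriv.continuous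
  have hodeY : ∀ x, Q.eval x • deriv Y x + ∑ j, (R j).eval x • T (B j) (Y x) =
      ∑ n ∈ Finset.range (S + 1), x ^ n • f n := by
    have hoff : ∀ x ∉ P, Q.eval x • deriv Y x + ∑ j, (R j).eval x • T (B j) (Y x) =
      ∑ n ∈ Finset.range (S + 1), x ^ n • f n := by
      intro x hx
      rw [(hYo x hx).deriv]
      have hQ0 : Q.eval x ≠ 0 := by
        rw [hQe]; exact Finset.prod_ne_zero_iff.2 fun j _ => hP x hx j
      simp only [A, b, _root_.neg_apply, _root_.sum_apply, _root_.smul_apply]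
      rw [← hQe, smul_add, smul_smul, mul_inv_cancel₀ hQ0, one_smul, smul_neg, Finset.smul_sum]
      have : ∀ j, Q.eval x • (x - p j)⁻¹ • T (B j) (Y x) = (R j).eval x • T (B j) (Y x) := by
        intro j
        rw [smul_smul, hQe, hRe, ← Finset.mul_prod_erase _ _ (Finset.mem_univ j)]
        congr 1
        field_simp [hP x hx j]
      simp only [this]
      abel
    have hcl : Dense ((P : Set ℂ)ᶜ) := P.finite_toSet.countable.dense_compl ℂ
    have hc1 : Continuous fun x => Q.eval x • deriv Y x + ∑ j, (R j).eval x • T (B j) (Y x) := by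
      refine (Q.continuous.smul hYc).add (continuous_finsetSum _ fun j _ =>
        (R j).continuous.smul ((T (B j)).continuous.comp hYd.continuous))
    have hc2 : Continuous fun x : ℂ => ∑ n ∈ Finset.range (S + 1), x ^ n • f n :=
      continuous_finsetSum _ fun n _ => (continuous_id.pow n).smul continuous_const
    intro x
    exact congrFun (hc1.ext_on hcl hc2 (fun x hx => hoff x hx)) x
  have hY0 : ∀ x, Y x = 0 := by
    refine aux_entire_zero S Q (Polynomial.monic_prod_of_monic _ _ fun j _ => Polynomial.monic_X_sub_C _)
      ?_ R (fun j => Polynomial.monic_prod_of_monic _ _ fun j _ => Polynomial.monic_X_sub_C _) ?_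
      (fun j => T (B j)) ?_ f Y hYd hodeY
    · simp [Q, Polynomial.natDegree_prod_of_monic _ _ (fun j _ => Polynomial.monic_X_sub_C (p j))]
    · intro j
      simp [R, Polynomial.natDegree_prod_of_monic _ _ (fun j _ => Polynomial.monic_X_sub_C (p j))]
    · intro n
      obtain ⟨m, hm⟩ := hinv n
      refine ⟨‖T (↑m⁻¹ : Matrix (Fin N) (Fin N) ℂ)‖, fun v => ?_⟩
      have h1 : (n : ℂ) • v + (∑ j, T (B j)) v = (m : Matrix (Fin N) (Fin N) ℂ) *ᵥ v := by
        rw [hm, Matrix.add_mulVec, Matrix.smul_mulVec, Matrix.one_mulVec, Matrix.sum_mulVec,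
          _root_.sum_apply]
        rfl
      have h2 : T (↑m⁻¹ : Matrix (Fin N) (Fin N) ℂ) ((n : ℂ) • v + (∑ j, T (B j)) v) = v := by
        rw [h1, hT, Matrix.mulVec_mulVec, m.inv_mul, Matrix.one_mulVec]
      calc ‖v‖ = ‖T (↑m⁻¹ : Matrix (Fin N) (Fin N) ℂ) ((n : ℂ) • v + (∑ j, T (B j)) v)‖ := by rw [h2]
        _ ≤ _ := ContinuousLinearMap.le_opNorm _ _
  constructor
  · have hz : ∀ x : ℂ, (fun i => (φ i).eval x) = 0 := by
      intro x
      have h1 : deriv Y x = 0 := by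
        have : Y = fun _ => 0 := funext hY0
        rw [this]; simp
      rw [hf, ← hodeY, h1]
      simp [hY0]
    funext i
    refine Polynomial.funext fun x => ?_
    have := congrFun (hz x) i
    simpa using this
  · have := hya.eqOn_of_preconnected_of_eventuallyEq (g := fun _ => 0) analyticOnNhd_const hDconn (hUD hu)
      (eventually_of_mem (hU.mem_nhds hu) fun x hx => by rw [← hUe hx, hY0])
    exact this

/-- Uniqueness of corrections (§4.2 of the paper): under condition (INV), if `φ₁, φ₂`
are polynomial corrections of degree at most `S` for which the corrected equations
`y' + B(x) y = Q(x)⁻¹ (g(x) − φᵢ(x))` admit solutions `y₁, y₂` analytic on the simply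
connected domain `D` containing all singularities, then `φ₁ = φ₂` and `y₁ = y₂` on `D`. -/
theorem stmt_7 (N S : ℕ) (hN : 1 ≤ N)
    (p : Fin (S + 2) → ℂ) (hp : Function.Injective p)
    (B : Fin (S + 2) → Matrix (Fin N) (Fin N) ℂ)
    (hinv : ∀ k : ℕ,
      (∀ j, IsUnit ((k : ℂ) • (1 : Matrix (Fin N) (Fin N) ℂ) + B j)) ∧
        IsUnit ((k : ℂ) • (1 : Matrix (Fin N) (Fin N) ℂ) + ∑ j, B j))
    (D : Set ℂ) (hD : IsOpen D) (hDconn : IsPreconnected D)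
    (hDsc : SimplyConnectedSpace D) (hpD : ∀ j, p j ∈ D)
    (g : ℂ → Fin N → ℂ) (hg : AnalyticOnNhd ℂ g D)
    (φ₁ φ₂ : Fin N → Polynomial ℂ)
    (hφ₁ : ∀ i, (φ₁ i).degree ≤ (S : ℕ)) (hφ₂ : ∀ i, (φ₂ i).degree ≤ (S : ℕ))
    (y₁ y₂ : ℂ → Fin N → ℂ)
    (hy₁a : AnalyticOnNhd ℂ y₁ D) (hy₂a : AnalyticOnNhd ℂ y₂ D)
    (hy₁ : ∀ x ∈ D \ Set.range p,
      HasDerivAt y₁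
        ((∏ j, (x - p j))⁻¹ • (g x - fun i => (φ₁ i).eval x)
          - (∑ j, (x - p j)⁻¹ • B j) *ᵥ y₁ x) x)
    (hy₂ : ∀ x ∈ D \ Set.range p,
      HasDerivAt y₂
        ((∏ j, (x - p j))⁻¹ • (g x - fun i => (φ₂ i).eval x)
          - (∑ j, (x - p j)⁻¹ • B j) *ᵥ y₂ x) x) :
    φ₁ = φ₂ ∧ Set.EqOn y₁ y₂ D := by
  have h := aux_main N S p B (fun k => (hinv k).2) D hD hDconn hpD (fun i => φ₂ i - φ₁ i)
    (fun i => (Polynomial.degree_sub_le _ _).trans (max_le (hφ₂ i) (hφ₁ i)))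
    (fun x => y₁ x - y₂ x) (hy₁a.sub hy₂a) (by
      intro x hx
      have h1 := (hy₁ x hx).sub (hy₂ x hx)
      have e : (∏ j, (x - p j))⁻¹ • (fun i => (φ₂ i - φ₁ i).eval x)
          - (∑ j, (x - p j)⁻¹ • B j) *ᵥ (y₁ x - y₂ x) =
          ((∏ j, (x - p j))⁻¹ • (g x - fun i => (φ₁ i).eval x)
            - (∑ j, (x - p j)⁻¹ • B j) *ᵥ y₁ x) -
          ((∏ j, (x - p j))⁻¹ • (g x - fun i => (φ₂ i).eval x)
            - (∑ j, (x - p j)⁻¹ • B j) *ᵥ y₂ x) := by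
        have e1 : (fun i => (φ₂ i - φ₁ i).eval x) =
            (g x - fun i => (φ₁ i).eval x) - (g x - fun i => (φ₂ i).eval x) := by
          funext i
          simp
        rw [e1, smul_sub, Matrix.mulVec_sub]
        abel
      rw [e]
      exact h1)
  refine ⟨?_, fun x hx => sub_eq_zero.1 (h.2 x hx)⟩
  funext i
  exact (sub_eq_zero.1 (congrFun h.1 i)).symm
end

section
/- Let M ∈ M_d(ℂ) have eigenvalues λ_1, …, λ_d (listed with multiplicity), and let n ≥ 2. Then the set of eigenvalues of the linear operator J_M on 𝒫_n is exactly { m·λ − λ_i : m ∈ ℕ^d with |m| = n, i ∈ {1, …, d} }, where m·λ = m_1 λ_1 + ⋯ + m_d λ_d. -/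
open Matrix Set

/-- `HomogPolyMap d n q` : `q : ℂᵈ → ℂᵈ` belongs to `𝒫_n`, i.e. it is a vector-valued
polynomial map homogeneous of degree `n`: `q(w) = Σ_{|m| = n} q_m w^m`. -/
def HomogPolyMap (d n : ℕ) (q : (Fin d → ℂ) → Fin d → ℂ) : Prop :=
  ∃ c : (Fin d → ℕ) → Fin d → ℂ,
    q = fun w =>
      ∑ m ∈ (Finset.Iic (fun _ => n : Fin d → ℕ)).filter (fun m => ∑ i, m i = n),
        (∏ i, w i ^ m i) • c m

/-- The derivation `p ↦ (w ↦ d_w p (M w))` on polynomials. -/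
noncomputable def DM {d : ℕ} (M : Matrix (Fin d) (Fin d) ℂ) :
    Derivation ℂ (MvPolynomial (Fin d) ℂ) (MvPolynomial (Fin d) ℂ) :=
  MvPolynomial.mkDerivation ℂ (fun i => ∑ j, M i j • (MvPolynomial.X j : MvPolynomial (Fin d) ℂ))

theorem DM_X {d : ℕ} (M : Matrix (Fin d) (Fin d) ℂ) (i : Fin d) :
    DM M (MvPolynomial.X i) = ∑ j, M i j • (MvPolynomial.X j : MvPolynomial (Fin d) ℂ) := by
  simp [DM, MvPolynomial.mkDerivation_X]

theorem aux_comm {d : ℕ} {V : Type*} [AddCommGroup V] [Module ℂ V]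
    (φ : (Fin d → ℂ) →ₗ[ℂ] V) (hφ : φ ≠ 0) (B : Matrix (Fin d) (Fin d) ℂ) (lam : Fin d → ℂ)
    (hB : B.charpoly = ∏ i, (Polynomial.X - Polynomial.C (lam i))) :
    ∃ k v, φ v ≠ 0 ∧ φ (B *ᵥ v) = lam k • φ v := by
  by_contra! h
  have key : ∀ (l : List (Fin d)) (v : Fin d → ℂ),
      φ ((Polynomial.aeval B (l.map fun i => Polynomial.X - Polynomial.C (lam i)).prod) *ᵥ v) = 0 →
        φ v = 0 := by
    intro l
    induction l with
    | nil => intro v hv; simpa using hv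
    | cons k l ih =>
      intro v hv
      rw [List.map_cons, List.prod_cons, mul_comm, map_mul, ← Matrix.mulVec_mulVec] at hv
      have h1 := ih _ hv
      by_contra hne
      apply h k v hne
      simpa [Matrix.sub_mulVec, Matrix.algebraMap_eq_diagonal, sub_eq_zero,
        Algebra.algebraMap_eq_smul_one, Matrix.smul_mulVec] using h1
  apply hφ
  apply LinearMap.ext
  intro v
  rw [LinearMap.zero_apply]
  apply key Finset.univ.toList
  rw [Finset.prod_map_toList, ← hB, Matrix.aeval_self_charpoly]
  simp

theorem der_sum_apply {d : ℕ}
    (D : Fin d → Derivation ℂ (MvPolynomial (Fin d) ℂ) (MvPolynomial (Fin d) ℂ))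
    (p : MvPolynomial (Fin d) ℂ) (s : Finset (Fin d)) : (∑ j ∈ s, D j) p = ∑ j ∈ s, D j p := by
  induction s using Finset.induction_on with
  | empty => simp
  | insert i s hi ih => rw [Finset.sum_insert hi, Finset.sum_insert hi, Derivation.add_apply, ih]

theorem DM_pderiv {d : ℕ} (M : Matrix (Fin d) (Fin d) ℂ) (k : Fin d)
    (p : MvPolynomial (Fin d) ℂ) :
    DM M (MvPolynomial.pderiv k p) =
      MvPolynomial.pderiv k (DM M p) - ∑ j, M j k • MvPolynomial.pderiv j p := by
  have : ⁅DM M, MvPolynomial.pderiv k⁆ = - ∑ j, M j k • MvPolynomial.pderiv (R := ℂ) j := by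
    apply MvPolynomial.derivation_ext
    intro i
    rw [Derivation.commutator_apply, DM_X]
    simp only [Derivation.neg_apply, der_sum_apply, Derivation.smul_apply,
      map_sum, Derivation.map_smul, MvPolynomial.pderiv_X]
    have h0 : DM M (Pi.single (M := fun _ => MvPolynomial (Fin d) ℂ) k 1 i) = 0 := by
      by_cases h : k = i
      · subst h; simp
      · rw [Pi.single_eq_of_ne (Ne.symm h), map_zero]
    rw [h0]
    simp [Pi.single_apply]
  have h2 := congrArg (fun D => D p) this
  simp only [Derivation.commutator_apply, Derivation.neg_apply, der_sum_apply, Derivation.smul_apply] at h2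
  rw [sub_eq_iff_eq_add.1 h2]
  ring

theorem DM_eig {d : ℕ} (M : Matrix (Fin d) (Fin d) ℂ) (lam : Fin d → ℂ)
    (hlam : M.charpoly = ∏ i, (Polynomial.X - Polynomial.C (lam i))) (n : ℕ) :
    ∀ (p : MvPolynomial (Fin d) ℂ) (a : ℂ), p.IsHomogeneous n → p ≠ 0 → DM M p = a • p →
      ∃ m : Fin d → ℕ, ∑ j, m j = n ∧ a = ∑ j, (m j : ℂ) * lam j := by
  induction n with
  | zero =>
    intro p a hp hp0 hD
    refine ⟨0, by simp, ?_⟩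
    rw [(MvPolynomial.totalDegree_eq_zero_iff_eq_C (p := p)).1
      (Nat.le_zero.1 hp.totalDegree_le)] at hD hp0
    rw [← MvPolynomial.algebraMap_eq, Derivation.map_algebraMap] at hD
    have := (smul_eq_zero.1 hD.symm).resolve_right hp0
    simpa using this
  | succ n ih =>
    intro p a hp hp0 hD
    let φ : (Fin d → ℂ) →ₗ[ℂ] MvPolynomial (Fin d) ℂ :=
      Fintype.linearCombination ℂ (fun k => MvPolynomial.pderiv k p)
    have hφa : ∀ u, φ u = ∑ k, u k • MvPolynomial.pderiv k p := fun u => rfl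
    have hφ : φ ≠ 0 := by
      intro h0
      have h1 : ∀ k, MvPolynomial.pderiv k p = 0 := by
        intro k
        have := congrArg (fun f => f (Pi.single k 1)) h0
        simpa [hφa, Pi.single_apply] using this
      have h2 := hp.sum_X_mul_pderiv
      simp only [h1, mul_zero, Finset.sum_const_zero] at h2
      have h3 := (smul_eq_zero.1 h2.symm).resolve_left (Nat.succ_ne_zero n)
      exact hp0 h3
    obtain ⟨k, v, hv, hk⟩ := aux_comm φ hφ M lam hlam
    have hDφ : DM M (φ v) = (a - lam k) • φ v := by
      have hg : ∀ k, DM M (MvPolynomial.pderiv k p) =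
          a • MvPolynomial.pderiv k p - ∑ j, M j k • MvPolynomial.pderiv j p := by
        intro k
        rw [DM_pderiv, hD, Derivation.map_smul]
      rw [sub_smul, ← hk, hφa, hφa, map_sum]
      simp only [Derivation.map_smul, hg, Matrix.mulVec, dotProduct, smul_sub,
        Finset.sum_sub_distrib, Finset.smul_sum, Finset.sum_smul, smul_smul]
      have e1 : ∑ x, (v x * a) • MvPolynomial.pderiv x p =
          ∑ x, (a * v x) • MvPolynomial.pderiv x p :=
        Finset.sum_congr rfl fun x _ => by rw [mul_comm]
      have e2 : ∑ x, ∑ y, (v x * M y x) • MvPolynomial.pderiv y p =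
          ∑ x, ∑ y, (M x y * v y) • MvPolynomial.pderiv x p := by
        rw [Finset.sum_comm]
        exact Finset.sum_congr rfl fun x _ => Finset.sum_congr rfl fun y _ => by rw [mul_comm]
      rw [e1, e2]
    have hhom : (φ v).IsHomogeneous n := by
      rw [hφa]
      apply MvPolynomial.IsHomogeneous.sum
      intro i _
      rw [MvPolynomial.smul_eq_C_mul]
      simpa using (MvPolynomial.isHomogeneous_C _ (v i)).mul (hp.pderiv (i := i))
    obtain ⟨m, hm, hma⟩ := ih _ _ hhom hv hDφ
    refine ⟨m + Pi.single k 1, ?_, ?_⟩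
    · simp [Finset.sum_add_distrib, hm]
    · rw [sub_eq_iff_eq_add.1 hma]
      simp [add_mul, Finset.sum_add_distrib, Pi.single_apply]

theorem eval_diff {d : ℕ} (p : MvPolynomial (Fin d) ℂ) :
    Differentiable ℂ (fun w : Fin d → ℂ => MvPolynomial.eval w p) := by
  induction p using MvPolynomial.induction_on with
  | C a => simp
  | add p q hp hq => simp only [map_add]; fun_prop
  | mul_X p i hp => simp only [map_mul, MvPolynomial.eval_X]; fun_prop

theorem eval_fderiv {d : ℕ} (M : Matrix (Fin d) (Fin d) ℂ) (p : MvPolynomial (Fin d) ℂ)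
    (w : Fin d → ℂ) :
    fderiv ℂ (fun w : Fin d → ℂ => MvPolynomial.eval w p) w (M *ᵥ w)
      = MvPolynomial.eval w (DM M p) := by
  induction p using MvPolynomial.induction_on with
  | C a =>
    rw [← MvPolynomial.algebraMap_eq, Derivation.map_algebraMap]
    simp [MvPolynomial.algebraMap_eq]
  | add p q hp hq =>
    simp only [map_add, ← hp, ← hq]
    rw [fderiv_fun_add (eval_diff p w) (eval_diff q w)]
    rfl
  | mul_X p i hp =>
    simp only [map_mul, MvPolynomial.eval_X]
    rw [fderiv_fun_mul (eval_diff p w) (by fun_prop), Derivation.leibniz, DM_X]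
    have hi : fderiv ℂ (fun w : Fin d → ℂ => w i) w (M *ᵥ w) = (M *ᵥ w) i := by
      exact congrArg (fun L => L (M *ᵥ w)) (ContinuousLinearMap.fderiv
        (ContinuousLinearMap.proj (R := ℂ) (φ := fun _ : Fin d => ℂ) i) (x := w))
    simp [hp, hi, Matrix.mulVec, dotProduct, MvPolynomial.smul_eval]

theorem homog_iff {d n : ℕ} (q : (Fin d → ℂ) → Fin d → ℂ) :
    HomogPolyMap d n q ↔ ∃ Q : Fin d → MvPolynomial (Fin d) ℂ,
      (∀ i, (Q i).IsHomogeneous n) ∧ q = fun w i => MvPolynomial.eval w (Q i) := by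
  constructor
  · rintro ⟨c, rfl⟩
    refine ⟨fun i => ∑ m ∈ (Finset.Iic (fun _ => n : Fin d → ℕ)).filter (fun m => ∑ i, m i = n),
      MvPolynomial.monomial (Finsupp.equivFunOnFinite.symm m) (c m i), ?_, ?_⟩
    · intro i
      apply MvPolynomial.IsHomogeneous.sum
      intro m hm
      apply MvPolynomial.isHomogeneous_monomial
      rw [Finsupp.degree_eq_sum]
      simpa using (Finset.mem_filter.1 hm).2
    · ext w i
      simp [MvPolynomial.eval_monomial, Finsupp.prod_fintype, mul_comm]
  · rintro ⟨Q, hQ, rfl⟩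
    refine ⟨fun m i => (Q i).coeff (Finsupp.equivFunOnFinite.symm m), ?_⟩
    ext w i
    rw [MvPolynomial.eval_eq', Finset.sum_apply]
    simp only [Pi.smul_apply, smul_eq_mul]
    symm
    apply Finset.sum_bij_ne_zero (fun m _ _ => Finsupp.equivFunOnFinite.symm m)
    · intro m _ h
      rw [MvPolynomial.mem_support_iff]
      exact right_ne_zero_of_mul h
    · intro a _ _ b _ _ h
      exact Finsupp.equivFunOnFinite.symm.injective h
    · intro b hb h
      have hdeg : ∑ i, b i = n := by
        have := hQ i (MvPolynomial.mem_support_iff.1 hb)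
        rw [← this, Finsupp.weight_apply]
        simp [Finsupp.sum_fintype]
      refine ⟨b, ?_, ?_, ?_⟩
      · rw [Finset.mem_filter, Finset.mem_Iic]
        refine ⟨fun j => ?_, hdeg⟩
        rw [← hdeg]
        exact Finset.single_le_sum (f := fun i => b i) (fun _ _ => Nat.zero_le _)
          (Finset.mem_univ j)
      · rw [mul_comm]
        simpa using h
      · ext; rfl
    · intro a _ _
      rw [mul_comm]
      rfl

theorem J_eval {d : ℕ} (M : Matrix (Fin d) (Fin d) ℂ) (Q : Fin d → MvPolynomial (Fin d) ℂ)
    (μ : ℂ) :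
    (∀ w, (fderiv ℂ (fun w i => MvPolynomial.eval w (Q i)) w) (M *ᵥ w)
      - M *ᵥ (fun i => MvPolynomial.eval w (Q i)) = μ • (fun i => MvPolynomial.eval w (Q i))) ↔
    ∀ i, DM M (Q i) - ∑ j, M i j • Q j = μ • Q i := by
  have h : ∀ w i, ((fderiv ℂ (fun w i => MvPolynomial.eval w (Q i)) w) (M *ᵥ w)) i =
      MvPolynomial.eval w (DM M (Q i)) := by
    intro w i
    rw [← eval_fderiv, fderiv_pi (fun i => eval_diff (Q i) w)]
    rfl
  constructor
  · intro H i
    apply MvPolynomial.funext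
    intro w
    have := congrFun (H w) i
    rw [Pi.sub_apply, h] at this
    simpa [Matrix.mulVec, dotProduct, MvPolynomial.smul_eval] using this
  · intro H w
    ext i
    have := congrArg (MvPolynomial.eval w) (H i)
    rw [Pi.sub_apply, h]
    simpa [Matrix.mulVec, dotProduct, MvPolynomial.smul_eval] using this

theorem exists_eigvec {d : ℕ} (M : Matrix (Fin d) (Fin d) ℂ) (lam : Fin d → ℂ)
    (hlam : M.charpoly = ∏ i, (Polynomial.X - Polynomial.C (lam i))) (k : Fin d) :
    ∃ v, v ≠ 0 ∧ M *ᵥ v = lam k • v := by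
  have h : (Matrix.scalar (Fin d) (lam k) - M).det = 0 := by
    rw [← Matrix.eval_charpoly, hlam, Polynomial.eval_prod]
    exact Finset.prod_eq_zero (Finset.mem_univ k) (by simp)
  obtain ⟨v, hv, hv2⟩ := Matrix.exists_mulVec_eq_zero_iff.2 h
  refine ⟨v, hv, ?_⟩
  rw [Matrix.sub_mulVec, sub_eq_zero] at hv2
  rw [← hv2]
  ext i
  simp [Matrix.scalar_apply, Matrix.mulVec_diagonal]

theorem DM_pow {d : ℕ} (M : Matrix (Fin d) (Fin d) ℂ) (p : MvPolynomial (Fin d) ℂ) (a : ℂ)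
    (h : DM M p = a • p) (m : ℕ) : DM M (p ^ m) = ((m : ℂ) * a) • p ^ m := by
  induction m with
  | zero => simp
  | succ m ih =>
    rw [pow_succ, Derivation.leibniz, ih, h]
    simp only [smul_eq_mul, MvPolynomial.smul_eq_C_mul, Nat.cast_succ, map_mul, map_add, map_one]
    ring

theorem DM_prod {d : ℕ} (M : Matrix (Fin d) (Fin d) ℂ) (p : Fin d → MvPolynomial (Fin d) ℂ)
    (a : Fin d → ℂ) (h : ∀ i, DM M (p i) = a i • p i) (s : Finset (Fin d)) :
    DM M (∏ i ∈ s, p i) = (∑ i ∈ s, a i) • ∏ i ∈ s, p i := by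
  induction s using Finset.induction_on with
  | empty => simp
  | insert i s hi ih =>
    rw [Finset.prod_insert hi, Finset.sum_insert hi, Derivation.leibniz, ih, h]
    simp only [smul_eq_mul, MvPolynomial.smul_eq_C_mul, map_add]
    ring

/-- Lemma 6 of the paper: if `M` has eigenvalues `λ₁, …, λ_d` (with multiplicity), then
the eigenvalues of the operator `J_M q = (d_w q)(M w) − M q` on `𝒫_n` are exactly the
numbers `m·λ − λᵢ` with `|m| = n`, `1 ≤ i ≤ d`. -/
theorem stmt_17 (d n : ℕ) (hd : 1 ≤ d) (hn : 2 ≤ n)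
    (M : Matrix (Fin d) (Fin d) ℂ) (lam : Fin d → ℂ)
    (hlam : M.charpoly = ∏ i, (Polynomial.X - Polynomial.C (lam i))) :
    ∀ μ : ℂ,
      (∃ q : (Fin d → ℂ) → Fin d → ℂ, HomogPolyMap d n q ∧ q ≠ 0 ∧
          ∀ w, (fderiv ℂ q w) (M *ᵥ w) - M *ᵥ q w = μ • q w)
        ↔ ∃ (m : Fin d → ℕ) (i : Fin d),
            (∑ j, m j = n) ∧ μ = (∑ j, (m j : ℂ) * lam j) - lam i := by
  intro μ
  have hlamT : Mᵀ.charpoly = ∏ i, (Polynomial.X - Polynomial.C (lam i)) := by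
    rw [Matrix.charpoly_transpose, hlam]
  constructor
  · rintro ⟨q, hq, hq0, hJ⟩
    obtain ⟨Q, hQ, rfl⟩ := (homog_iff q).1 hq
    have hJ' := (J_eval M Q μ).1 hJ
    let φ : (Fin d → ℂ) →ₗ[ℂ] MvPolynomial (Fin d) ℂ := Fintype.linearCombination ℂ Q
    have hφa : ∀ u, φ u = ∑ k, u k • Q k := fun u => rfl
    have hφ : φ ≠ 0 := by
      intro h0
      apply hq0
      ext w i
      have := congrArg (fun f => f (Pi.single i 1)) h0
      have h1 : Q i = 0 := by simpa [hφa, Pi.single_apply] using this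
      simp [h1]
    obtain ⟨k, v, hv, hk⟩ := aux_comm φ hφ Mᵀ lam hlamT
    have hDφ : DM M (φ v) = (μ + lam k) • φ v := by
      rw [add_smul, ← hk, hφa, hφa, map_sum]
      simp only [Derivation.map_smul, fun i => sub_eq_iff_eq_add.1 (hJ' i), Matrix.mulVec,
        dotProduct, smul_add, Finset.sum_add_distrib, Finset.smul_sum, Finset.sum_smul, smul_smul,
        Matrix.transpose_apply]
      congr 1
      · simp only [mul_comm]
      · rw [Finset.sum_comm]
        simp only [mul_comm]
    have hhom : (φ v).IsHomogeneous n := by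
      rw [hφa]
      apply MvPolynomial.IsHomogeneous.sum
      intro i _
      rw [MvPolynomial.smul_eq_C_mul]
      simpa using (MvPolynomial.isHomogeneous_C _ (v i)).mul (hQ i)
    obtain ⟨m, hm, hma⟩ := DM_eig M lam hlam n _ _ hhom hv hDφ
    exact ⟨m, k, hm, eq_sub_of_add_eq hma⟩
  · rintro ⟨m, i, hm, rfl⟩
    obtain ⟨v, hv0, hv⟩ := exists_eigvec M lam hlam i
    choose u hu0 hu using exists_eigvec Mᵀ lam hlamT
    let l : Fin d → MvPolynomial (Fin d) ℂ := fun k => ∑ j, u k j • MvPolynomial.X j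
    have hl0 : ∀ k, l k ≠ 0 := by
      intro k h0
      apply hu0 k
      ext j
      have := congrArg (MvPolynomial.eval (Pi.single j 1)) h0
      simpa [l, MvPolynomial.smul_eval, Pi.single_apply] using this
    have hlD : ∀ k, DM M (l k) = lam k • l k := by
      intro k
      have h1 : ∀ j, lam k * u k j = ∑ i, M i j * u k i := by
        intro j
        have := congrFun (hu k) j
        simpa [Matrix.mulVec, dotProduct] using this.symm
      simp only [l, map_sum, Derivation.map_smul, DM_X, Finset.smul_sum, smul_smul, h1,
        Finset.sum_smul]
      rw [Finset.sum_comm]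
      simp only [mul_comm]
    have hlh : ∀ k, (l k).IsHomogeneous 1 := by
      intro k
      apply MvPolynomial.IsHomogeneous.sum
      intro i _
      rw [MvPolynomial.smul_eq_C_mul]
      simpa using (MvPolynomial.isHomogeneous_C _ (u k i)).mul (MvPolynomial.isHomogeneous_X ℂ i)
    let p := ∏ k, l k ^ m k
    have hp0 : p ≠ 0 := Finset.prod_ne_zero_iff.2 fun k _ => pow_ne_zero _ (hl0 k)
    have hpD : DM M p = (∑ j, (m j : ℂ) * lam j) • p :=
      DM_prod M _ _ (fun k => DM_pow M _ _ (hlD k) (m k)) _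
    have hph : p.IsHomogeneous n := by
      rw [← hm]
      apply MvPolynomial.IsHomogeneous.prod
      intro k _
      simpa using (hlh k).pow (m k)
    refine ⟨fun w j => MvPolynomial.eval w (v j • p),
      (homog_iff _).2 ⟨fun j => v j • p, ?_, rfl⟩, ?_, ?_⟩
    · intro j
      beta_reduce
      rw [MvPolynomial.smul_eq_C_mul]
      simpa using (MvPolynomial.isHomogeneous_C _ (v j)).mul hph
    · intro h0
      obtain ⟨j, hj⟩ := Function.ne_iff.1 hv0
      have : v j • p = 0 := by
        apply MvPolynomial.funext
        intro w
        simpa using congrFun (congrFun h0 w) j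
      exact (smul_ne_zero hj hp0) this
    · apply (J_eval M (fun j => v j • p) _).2
      intro j
      have h1 : ∑ k, M j k * v k = lam i * v j := by
        simpa [Matrix.mulVec, dotProduct] using congrFun hv j
      simp only [Derivation.map_smul, hpD, smul_smul, ← Finset.sum_smul, h1, ← sub_smul]
      congr 1
      ring
end
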